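/- arXiv:2309.12831 — 2 statements merged into one kernel-verified Lean document; each statement's English description precedes it below -/
import Mathlib

section
/- Let G be a finitely generated virtually abelian group containing a torsion-free abelian normal subgroup K ≅ ℤ^m of finite index, and let φ : G/K → Aut(K) ≅ GL(m,ℤ) be the integral representation induced by the conjugation action of G on K. Let k (with 0 ≤ k ≤ m) be the maximal dimension of an irreducible subrepresentation of φ over ℂ. Then for any finite generating set of G, RF_{G,ν(G),B_G} ≈ log^k (where log^0 means a bounded function). -/
/-- The word ball of radius `r` in a group `G` with respect to a finite (generating)
set `S`: products of at most `r` elements of `S ∪ S⁻¹`. -/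
def wordBall {G : Type*} [Group G] (S : Finset G) (r : ℝ) : Set G :=
  {g | ∃ l : List G, (∀ x ∈ l, x ∈ S ∨ x⁻¹ ∈ S) ∧ (l.length : ℝ) ≤ r ∧ l.prod = g}

/-- `ν(G)`: the set of finite-index normal subgroups of `G`. -/
def nu (G : Type*) [Group G] : Set (Subgroup G) :=
  {N | N.Normal ∧ N.FiniteIndex}

/-- The divisibility function `D_{G,P}(g) = min {[G:N] : N ∈ P, g ∉ N}`, with value `∞`
when no such `N` exists (in particular at `g = 1`). -/
noncomputable def divFn {G : Type*} [Group G] (P : Set (Subgroup G)) (g : G) : ℕ∞ :=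
  sInf {n : ℕ∞ | ∃ N ∈ P, g ∉ N ∧ n = (N.index : ℕ∞)}

/-- The residual finiteness growth function
`RF_{G,P,B_G}(r) = max {D_{G,P}(g) : 1 ≠ g ∈ B_G(r)}` (as a real-valued function,
taking the value `1` on an empty set of elements). -/
noncomputable def RFgrowth {G : Type*} [Group G] (P : Set (Subgroup G)) (S : Finset G)
    (r : ℝ) : ℝ :=
  sSup (insert 1 ((fun g => ((divFn P g).toNat : ℝ)) '' (wordBall S r \ {1})))

/-- `f ⪯ g`: there is `C > 0` with `f(r) ≤ C·g(C·r)` for all `r ≥ max {1, 1/C}`. -/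
def GrowthLE (f g : ℝ → ℝ) : Prop :=
  ∃ C : ℝ, 0 < C ∧ ∀ r : ℝ, max 1 (1 / C) ≤ r → f r ≤ C * g (C * r)

/-- `f ≈ g`: `f ⪯ g` and `g ⪯ f`. -/
def GrowthEquiv (f g : ℝ → ℝ) : Prop :=
  GrowthLE f g ∧ GrowthLE g f

/-- A `ℂ`-subspace `W ⊆ ℂ^m` is invariant under the (complexified) family of integer
matrices `ρ`. -/
def InvariantC {ι : Type*} {m : ℕ} (ρ : ι → Matrix (Fin m) (Fin m) ℤ)
    (W : Submodule ℂ (Fin m → ℂ)) : Prop :=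
  ∀ i : ι, ∀ v ∈ W, ((ρ i).map (Int.cast : ℤ → ℂ)).mulVec v ∈ W

/-- `W` is an irreducible `ℂ`-subrepresentation: nonzero, invariant, and containing
no proper nonzero invariant subspace. -/
def IsIrredC {ι : Type*} {m : ℕ} (ρ : ι → Matrix (Fin m) (Fin m) ℤ)
    (W : Submodule ℂ (Fin m → ℂ)) : Prop :=
  W ≠ ⊥ ∧ InvariantC ρ W ∧
    ∀ W' : Submodule ℂ (Fin m → ℂ), W' ≤ W → W' ≠ ⊥ → InvariantC ρ W' → W' = W

section
open Finset

lemma norm_sum_range_character_le {q : ℕ} [NeZero q] {χ : DirichletCharacter ℂ q} (hχ : χ ≠ 1)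
    (n : ℕ) : ‖∑ i ∈ range n, χ (i : ZMod q)‖ ≤ q := by
  have hper : ∑ i ∈ range q, χ (i : ZMod q) = 0 := by
    rw [← MulChar.sum_eq_zero_of_ne_one hχ]
    refine Finset.sum_bij (fun i _ => (i : ZMod q)) (by simp) ?_ ?_ (by simp)
    · intro a ha b hb h
      simp only [mem_range] at ha hb
      have := (ZMod.natCast_eq_natCast_iff' a b q).1 h
      rwa [Nat.mod_eq_of_lt ha, Nat.mod_eq_of_lt hb] at this
    · intro b _
      exact ⟨b.val, by simpa using ZMod.val_lt b, by simp⟩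
  have hmul (j : ℕ) (r : ℕ) : ∑ i ∈ range (q * j + r), χ (i : ZMod q) =
      ∑ i ∈ range r, χ (i : ZMod q) := by
    induction j with
    | zero => simp
    | succ j ih =>
      rw [show q * (j + 1) + r = q + (q * j + r) by ring, sum_range_add, hper, zero_add, ← ih]
      simp
  rw [← Nat.div_add_mod n q, hmul]
  refine (norm_sum_le _ _).trans ?_
  refine (Finset.sum_le_sum (fun i _ => χ.norm_le_one _)).trans ?_
  simp only [sum_const, card_range, nsmul_eq_mul, mul_one, Nat.cast_le]
  exact (Nat.mod_lt _ (NeZero.pos q)).le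

/-- Dirichlet's test, in the form of an explicit bound. -/
lemma norm_sum_Ico_mul_le {g : ℕ → ℂ} {B : ℝ} (hB : ∀ n, ‖∑ i ∈ range n, g i‖ ≤ B)
    {f : ℕ → ℝ} {M N : ℕ} (hf : ∀ i, M ≤ i → f (i + 1) ≤ f i) (hf0 : ∀ i, M ≤ i → 0 ≤ f i) :
    ‖∑ i ∈ Ico M N, (f i : ℂ) * g i‖ ≤ 2 * B * f M := by
  have hB0 : 0 ≤ B := (norm_nonneg _).trans (hB 0)
  rcases le_or_gt N M with h | h
  · rw [Ico_eq_empty_of_le h]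
    simpa using mul_nonneg (by linarith) (hf0 M le_rfl)
  have key := sum_Ico_by_parts (fun i => (f i : ℂ)) g h
  simp only [smul_eq_mul] at key
  rw [key]
  have hlast : 0 ≤ f (N - 1) := hf0 _ (by omega)
  have h3 : ‖∑ i ∈ Ico M (N - 1), ((f (i + 1) : ℂ) - f i) * ∑ j ∈ range (i + 1), g j‖ ≤
      B * (f M - f (N - 1)) := by
    refine (norm_sum_le _ _).trans ?_
    calc _ ≤ ∑ i ∈ Ico M (N - 1), B * (f i - f (i + 1)) := by
          refine Finset.sum_le_sum fun i hi => ?_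
          rw [norm_mul, mul_comm, ← Complex.ofReal_sub, Complex.norm_real, Real.norm_eq_abs,
            abs_sub_comm, abs_of_nonneg (sub_nonneg.2 (hf i (mem_Ico.1 hi).1))]
          exact mul_le_mul_of_nonneg_right (hB _) (sub_nonneg.2 (hf i (mem_Ico.1 hi).1))
      _ = _ := by
          rw [← mul_sum]
          congr 1
          have := Finset.sum_Ico_sub f (show M ≤ N - 1 by omega)
          have h2 : ∑ i ∈ Ico M (N - 1), (f i - f (i + 1)) =
              -∑ i ∈ Ico M (N - 1), (f (i + 1) - f i) := by
            rw [← sum_neg_distrib]; simp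
          rw [h2, this]; ring
  have h1 : ‖(f (N - 1) : ℂ) * ∑ j ∈ range N, g j‖ ≤ f (N - 1) * B := by
    rw [norm_mul, Complex.norm_real, Real.norm_eq_abs, abs_of_nonneg hlast]
    exact mul_le_mul_of_nonneg_left (hB _) hlast
  have h2 : ‖(f M : ℂ) * ∑ j ∈ range M, g j‖ ≤ f M * B := by
    rw [norm_mul, Complex.norm_real, Real.norm_eq_abs, abs_of_nonneg (hf0 _ le_rfl)]
    exact mul_le_mul_of_nonneg_left (hB _) (hf0 _ le_rfl)
  refine (norm_sub_le _ _).trans ?_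
  have := norm_sub_le ((f (N - 1) : ℂ) * ∑ j ∈ range N, g j) ((f M : ℂ) * ∑ j ∈ range M, g j)
  linarith

/-- The partial sums of `∑ χ(n)/n` converge to `L(1, χ)` at rate `O(1/N)`. -/
lemma norm_LFunction_one_sub_sum_le {q : ℕ} [NeZero q] {χ : DirichletCharacter ℂ q} (hχ : χ ≠ 1)
    (N : ℕ) : ‖χ.LFunction 1 - ∑ i ∈ Ico 1 (N + 1), χ (i : ZMod q) / i‖ ≤ 2 * q / (N + 1) := by
  have hs : ∀ s : ℝ, 1 < s → ‖χ.LFunction s - ∑ i ∈ Ico 1 (N + 1),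
      χ (i : ZMod q) * (i : ℂ) ^ (-(s : ℂ))‖ ≤ 2 * q / (N + 1) := by
    intro s hs
    have hs' : 1 < (s : ℂ).re := by simpa
    have hsum := (DirichletCharacter.LSeriesSummable_of_one_lt_re χ hs').hasSum
    have ht := hsum.tendsto_sum_nat
    change Filter.Tendsto _ _ (nhds (LSeries _ _)) at ht
    rw [← DirichletCharacter.LFunction_eq_LSeries χ hs'] at ht
    refine le_of_tendsto (((ht.sub_const _)).norm) ?_
    filter_upwards [Filter.eventually_ge_atTop (N + 1)] with n hn
    have e1 : ∑ i ∈ range n, LSeries.term (fun n => χ (n : ZMod q)) s i =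
        ∑ i ∈ Ico 1 n, ((((i : ℝ) ^ (-s) : ℝ)) : ℂ) * χ (i : ZMod q) := by
      rw [range_eq_Ico, Finset.sum_eq_sum_Ico_succ_bot (by omega)]
      rw [LSeries.term_zero, zero_add]
      refine Finset.sum_congr rfl fun i hi => ?_
      rw [LSeries.term_of_ne_zero (by have := (mem_Ico.1 hi).1; omega), Complex.ofReal_cpow (by positivity),
        div_eq_mul_inv, ← Complex.cpow_neg]
      push_cast; ring
    have e2 : ∑ i ∈ Ico 1 (N + 1), χ (i : ZMod q) * (i : ℂ) ^ (-(s : ℂ)) =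
        ∑ i ∈ Ico 1 (N + 1), ((((i : ℝ) ^ (-s) : ℝ)) : ℂ) * χ (i : ZMod q) := by
      refine Finset.sum_congr rfl fun i hi => ?_
      rw [Complex.ofReal_cpow (by positivity)]
      push_cast; ring
    rw [e1, e2, ← Finset.sum_Ico_consecutive _ (show 1 ≤ N + 1 by omega) hn, add_sub_cancel_left]
    refine (norm_sum_Ico_mul_le (norm_sum_range_character_le hχ) ?_ ?_).trans ?_
    · intro i hi
      exact Real.rpow_le_rpow_of_nonpos (by norm_cast; omega) (by push_cast; linarith) (by linarith)
    · intro i _; positivity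
    · rw [div_eq_mul_inv]
      refine mul_le_mul_of_nonneg_left ?_ (by positivity)
      rw [← Real.rpow_neg_one]
      push_cast
      exact Real.rpow_le_rpow_of_exponent_le (by linarith [(Nat.cast_nonneg N : (0:ℝ) ≤ N)]) (by linarith)
  have hlim : Filter.Tendsto (fun s : ℝ => ‖χ.LFunction s - ∑ i ∈ Ico 1 (N + 1),
      χ (i : ZMod q) * (i : ℂ) ^ (-(s : ℂ))‖) (nhdsWithin 1 (Set.Ioi 1))
      (nhds ‖χ.LFunction (1 : ℝ) - ∑ i ∈ Ico 1 (N + 1),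
      χ (i : ZMod q) * (i : ℂ) ^ (-((1 : ℝ) : ℂ))‖) := by
    refine (Continuous.tendsto ?_ 1).mono_left nhdsWithin_le_nhds
    refine Continuous.norm (Continuous.sub ?_ ?_)
    · exact (DirichletCharacter.differentiable_LFunction hχ).continuous.comp Complex.continuous_ofReal
    · refine continuous_finsetSum _ fun i hi => continuous_const.mul ?_
      exact Continuous.const_cpow (by fun_prop) (Or.inl (by have := (mem_Ico.1 hi).1; norm_cast; omega))
  have := le_of_tendsto hlim (Filter.eventually_of_mem self_mem_nhdsWithin fun s hs' => hs s hs')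
  simpa [Complex.cpow_neg_one, div_eq_mul_inv] using this

end

section
open Finset ArithmeticFunction

lemma log_succ_div_le {i : ℕ} (hi : 3 ≤ i) :
    Real.log ((i + 1 : ℕ) : ℝ) / ((i + 1 : ℕ) : ℝ) ≤ Real.log i / i := by
  have h3 : Real.exp 1 ≤ i := (Real.exp_one_lt_d9.le).trans
    (le_trans (by norm_num) (by exact_mod_cast hi : (3 : ℝ) ≤ i))
  exact Real.log_div_self_antitoneOn h3 (h3.trans (by push_cast; linarith)) (by push_cast; linarith)

lemma exists_norm_sum_character_mul_log_div_le {q : ℕ} [NeZero q] {χ : DirichletCharacter ℂ q}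
    (hχ : χ ≠ 1) : ∃ C : ℝ, ∀ N : ℕ,
      ‖∑ n ∈ Ioc 0 N, ((Real.log n / n : ℝ) : ℂ) * χ (n : ZMod q)‖ ≤ C := by
  refine ⟨∑ n ∈ Ico (1 : ℕ) 3, ‖((Real.log n / n : ℝ) : ℂ) * χ (n : ZMod q)‖ +
    2 * q * (Real.log (3 : ℕ) / (3 : ℕ)), fun N => ?_⟩
  have hpos : 0 ≤ 2 * q * (Real.log (3 : ℕ) / (3 : ℕ)) := by positivity
  rw [show Ioc 0 N = Ico 1 (N + 1) by ext; simp; omega]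
  rcases le_or_gt 3 (N + 1) with h | h
  · rw [← Finset.sum_Ico_consecutive _ (show 1 ≤ 3 by norm_num) h]
    refine (norm_add_le _ _).trans (add_le_add (norm_sum_le _ _) ?_)
    exact norm_sum_Ico_mul_le (f := fun n : ℕ => Real.log n / n) (norm_sum_range_character_le hχ)
      (fun i hi => log_succ_div_le hi)
      (fun i hi => div_nonneg (Real.log_natCast_nonneg i) (Nat.cast_nonneg i))
  · refine (norm_sum_le _ _).trans ?_
    refine (Finset.sum_le_sum_of_subset_of_nonneg
      (Ico_subset_Ico_right h.le) fun _ _ _ => norm_nonneg _).trans (by linarith)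

/-- Mertens' estimate twisted by a nontrivial character. -/
lemma exists_norm_sum_character_mul_vonMangoldt_div_le {q : ℕ} [NeZero q]
    {χ : DirichletCharacter ℂ q} (hχ : χ ≠ 1) : ∃ C : ℝ, ∀ N : ℕ,
      ‖∑ d ∈ Ioc 0 N, χ (d : ZMod q) * Λ d / d‖ ≤ C := by
  obtain ⟨C, hC⟩ := exists_norm_sum_character_mul_log_div_le hχ
  have hL : χ.LFunction 1 ≠ 0 := DirichletCharacter.LFunction_apply_one_ne_zero hχ
  refine ⟨(C + 2 * q * (Real.log 4 + 4)) / ‖χ.LFunction 1‖, fun N => ?_⟩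
  rw [le_div_iff₀ (norm_pos_iff.2 hL), ← norm_mul]
  let f : ArithmeticFunction ℂ := ⟨fun d => χ (d : ZMod q) * Λ d / d, by simp⟩
  let g : ArithmeticFunction ℂ := ⟨fun d => χ (d : ZMod q) / d, by simp⟩
  have hfg (n : ℕ) (hn : n ∈ Ioc 0 N) :
      (f * g) n = ((Real.log n / n : ℝ) : ℂ) * χ (n : ZMod q) := by
    have hn0 : n ≠ 0 := by have := (mem_Ioc.1 hn).1; omega
    rw [ArithmeticFunction.mul_apply]
    have h1 : ∀ x ∈ n.divisorsAntidiagonal, f x.1 * g x.2 =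
        (χ (n : ZMod q) / n) * ((Λ x.1 : ℝ) : ℂ) := by
      intro x hx
      obtain ⟨hx1, -⟩ := Nat.mem_divisorsAntidiagonal.1 hx
      change χ (x.1 : ZMod q) * Λ x.1 / x.1 * (χ (x.2 : ZMod q) / x.2) = _
      rw [← hx1]
      push_cast
      rw [map_mul]
      ring
    rw [Finset.sum_congr rfl h1, ← mul_sum, ← Complex.ofReal_sum,
      Nat.sum_divisorsAntidiagonal (f := fun i _ => Λ i), vonMangoldt_sum]
    push_cast; ring
  have hyp := sum_Ioc_mul_eq_sum_sum f g N
  rw [Finset.sum_congr rfl hfg] at hyp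
  have hN := hC N
  rw [hyp] at hN
  have hψ : ∑ d ∈ Ioc 0 N, ‖f d * (χ.LFunction 1 - ∑ m ∈ Ioc 0 (N / d), g m)‖ ≤
      2 * q * (Real.log 4 + 4) := by
    rcases Nat.eq_zero_or_pos N with rfl | hNpos
    · simp; positivity
    have hNr : (0 : ℝ) < N := by exact_mod_cast hNpos
    calc _ ≤ ∑ d ∈ Ioc 0 N, (2 * q / N) * Λ d := by
          refine Finset.sum_le_sum fun d hd => ?_
          have hd0 : 0 < d := (mem_Ioc.1 hd).1
          have hdr : (0 : ℝ) < d := by exact_mod_cast hd0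
          rw [norm_mul]
          have h1 : ‖f d‖ ≤ Λ d / d := by
            change ‖χ (d : ZMod q) * Λ d / d‖ ≤ _
            rw [norm_div, norm_mul, Complex.norm_real, Complex.norm_natCast, Real.norm_eq_abs,
              abs_of_nonneg vonMangoldt_nonneg]
            gcongr
            exact mul_le_of_le_one_left vonMangoldt_nonneg (χ.norm_le_one _)
          have h2 := norm_LFunction_one_sub_sum_le hχ (N / d)
          rw [show Ico 1 (N / d + 1) = Ioc 0 (N / d) by ext; simp; omega] at h2
          have h3 : (N : ℝ) / d ≤ ((N / d : ℕ) : ℝ) + 1 := by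
            rw [← Nat.floor_div_eq_div (K := ℝ)]
            exact (Nat.lt_floor_add_one _).le
          have h4 : (2 * q : ℝ) / (((N / d : ℕ) : ℝ) + 1) ≤ 2 * q / (N / d) := by
            gcongr
          calc _ ≤ Λ d / d * (2 * q / (N / d)) :=
                mul_le_mul h1 (h2.trans h4) (norm_nonneg _) (div_nonneg vonMangoldt_nonneg hdr.le)
            _ = _ := by field_simp
      _ = (2 * q / N) * Chebyshev.psi N := by
          rw [← mul_sum, Chebyshev.psi, Nat.floor_natCast]
      _ ≤ (2 * q / N) * ((Real.log 4 + 4) * N) := by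
          gcongr
          exact Chebyshev.psi_le_const_mul_self hNr.le
      _ = _ := by field_simp
  have hsplit : (∑ d ∈ Ioc 0 N, χ (d : ZMod q) * Λ d / d) * χ.LFunction 1 =
      ∑ d ∈ Ioc 0 N, f d * ∑ m ∈ Ioc 0 (N / d), g m +
      ∑ d ∈ Ioc 0 N, f d * (χ.LFunction 1 - ∑ m ∈ Ioc 0 (N / d), g m) := by
    rw [← sum_add_distrib, sum_mul]
    refine Finset.sum_congr rfl fun d _ => ?_
    rw [← mul_add, add_sub_cancel]; rfl
  rw [hsplit]
  exact (norm_add_le _ _).trans (add_le_add hN ((norm_sum_le _ _).trans hψ))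

/-- **Mertens' first theorem** for the von Mangoldt function. -/
lemma abs_sum_vonMangoldt_div_sub_log_le {N : ℕ} (hN : 0 < N) :
    |∑ d ∈ Ioc 0 N, Λ d / d - Real.log N| ≤ Real.log 4 + 4 := by
  have hNr : (0 : ℝ) < N := by exact_mod_cast hN
  have hfac : ∑ d ∈ Ioc 0 N, Λ d * ((N / d : ℕ) : ℝ) = Real.log (N.factorial) := by
    rw [← sum_Ioc_mul_zeta_eq_sum, vonMangoldt_mul_zeta, ← Finset.prod_Ico_id_eq_factorial,
      show Ico 1 (N + 1) = Ioc 0 N by ext; simp; omega,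
      Nat.cast_prod, Real.log_prod]
    · simp [log_apply]
    · intro i hi
      have := (mem_Ioc.1 hi).1
      positivity
  have hup : Real.log N.factorial ≤ N * ∑ d ∈ Ioc 0 N, Λ d / d := by
    rw [← hfac, mul_sum]
    refine Finset.sum_le_sum fun d _ => ?_
    rw [mul_div_left_comm]
    exact mul_le_mul_of_nonneg_left Nat.cast_div_le vonMangoldt_nonneg
  have hlow : N * ∑ d ∈ Ioc 0 N, Λ d / d - (Real.log 4 + 4) * N ≤ Real.log N.factorial := by
    have hpsi := Chebyshev.psi_le_const_mul_self hNr.le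
    rw [Chebyshev.psi, Nat.floor_natCast] at hpsi
    refine (sub_le_sub_left hpsi _).trans ?_
    rw [← hfac, mul_sum, ← sum_sub_distrib]
    refine Finset.sum_le_sum fun d _ => ?_
    have h3 : (N : ℝ) / d ≤ ((N / d : ℕ) : ℝ) + 1 := by
      rw [← Nat.floor_div_eq_div (K := ℝ)]
      exact (Nat.lt_floor_add_one _).le
    have := mul_le_mul_of_nonneg_left h3 (vonMangoldt_nonneg (n := d))
    rw [mul_div_left_comm]
    linarith
  have hst1 : N * Real.log N - N ≤ Real.log N.factorial := by
    have h : (N : ℝ) ^ N / N.factorial ≤ Real.exp N := by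
      exact Real.pow_div_factorial_le_exp N hNr.le N
    rw [div_le_iff₀ (by positivity)] at h
    have := Real.log_le_log (by positivity) h
    rw [Real.log_pow, Real.log_mul (by positivity) (by positivity), Real.log_exp] at this
    linarith
  have hst2 : Real.log N.factorial ≤ N * Real.log N := by
    rw [← Real.log_pow]
    refine Real.log_le_log (by positivity) ?_
    exact_mod_cast Nat.factorial_le_pow N
  have hlog4 : 0 ≤ Real.log 4 := Real.log_nonneg (by norm_num)
  rw [abs_le]
  constructor <;> refine le_of_mul_le_mul_left ?_ hNr <;> nlinarith

end

section
open Finset ArithmeticFunction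

lemma exists_sum_vonMangoldt_not_prime_div_le :
    ∃ C : ℝ, ∀ s : Finset ℕ, ∑ d ∈ s, (if d.Prime then 0 else Λ d) / d ≤ C := by
  have h := vonMangoldt.summable_residueClass_non_primes_div (q := 1) 0
  have he : ∀ n : ℕ, vonMangoldt.residueClass (q := 1) 0 n = Λ n := fun n => by
    simp [vonMangoldt.residueClass, Set.indicator, Subsingleton.elim (n : ZMod 1) 0]
  simp only [he] at h
  refine ⟨_, fun s => h.sum_le_tsum s fun i _ => ?_⟩
  have := vonMangoldt_nonneg (n := i)
  positivity

lemma exists_abs_sum_one_mul_vonMangoldt_div_sub_log_le (q : ℕ) [NeZero q] : ∃ C : ℝ,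
    ∀ N : ℕ, 0 < N → ‖∑ d ∈ Ioc 0 N, (1 : DirichletCharacter ℂ q) (d : ZMod q) * Λ d / d -
      (Real.log N : ℝ)‖ ≤ C := by
  obtain ⟨C, hC⟩ := exists_sum_vonMangoldt_not_prime_div_le
  refine ⟨(Real.log 4 + 4) + (C + ∑ p ∈ q.primeFactors, Λ p / p), fun N hN => ?_⟩
  have hsplit : ∑ d ∈ Ioc 0 N, (1 : DirichletCharacter ℂ q) (d : ZMod q) * Λ d / d -
      (Real.log N : ℝ) = ((∑ d ∈ Ioc 0 N, Λ d / d - Real.log N : ℝ) : ℂ) -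
      ((∑ d ∈ Ioc 0 N with ¬ d.Coprime q, Λ d / d : ℝ) : ℂ) := by
    rw [← Finset.sum_filter_add_sum_filter_not (Ioc 0 N) (fun d => d.Coprime q) (fun d => Λ d / d)]
    push_cast
    rw [← Finset.sum_filter_add_sum_filter_not (Ioc 0 N) (fun d => d.Coprime q)
      (fun d => (1 : DirichletCharacter ℂ q) (d : ZMod q) * Λ d / d)]
    have h0 : ∑ d ∈ Ioc 0 N with ¬ d.Coprime q,
        (1 : DirichletCharacter ℂ q) (d : ZMod q) * Λ d / d = 0 := by
      refine Finset.sum_eq_zero fun d hd => ?_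
      rw [MulChar.map_nonunit, zero_mul, zero_div]
      rw [ZMod.isUnit_iff_coprime]
      exact (mem_filter.1 hd).2
    have h1 : ∑ d ∈ Ioc 0 N with d.Coprime q,
        (1 : DirichletCharacter ℂ q) (d : ZMod q) * Λ d / d =
        ∑ d ∈ Ioc 0 N with d.Coprime q, (Λ d : ℂ) / d := by
      refine Finset.sum_congr rfl fun d hd => ?_
      rw [MulChar.one_apply ((ZMod.isUnit_iff_coprime d q).2 (mem_filter.1 hd).2), one_mul]
    rw [h0, h1]
    ring
  rw [hsplit]
  refine (norm_sub_le _ _).trans (add_le_add ?_ ?_)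
  · rw [Complex.norm_real]
    exact abs_sum_vonMangoldt_div_sub_log_le hN
  · have hnn : ∀ d : ℕ, 0 ≤ Λ d / d := fun d => div_nonneg vonMangoldt_nonneg d.cast_nonneg
    rw [Complex.norm_real, Real.norm_eq_abs, abs_of_nonneg (Finset.sum_nonneg fun d _ => hnn d)]
    calc _ ≤ ∑ d ∈ Ioc 0 N with ¬ d.Coprime q, ((if d.Prime then 0 else Λ d) / d +
            if d ∈ q.primeFactors then Λ d / d else 0) := by
          refine Finset.sum_le_sum fun d hd => ?_
          by_cases hp : d.Prime
          · have hdq : d ∣ q := by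
              by_contra hdq
              exact (mem_filter.1 hd).2 ((Nat.Prime.coprime_iff_not_dvd hp).2 hdq)
            rw [if_pos hp, if_pos (Nat.mem_primeFactors.2 ⟨hp, hdq, NeZero.ne q⟩)]
            simp
          · rw [if_neg hp]
            have : 0 ≤ if d ∈ q.primeFactors then Λ d / d else 0 := by
              split_ifs
              exacts [hnn d, le_rfl]
            linarith
      _ ≤ _ := by
          rw [sum_add_distrib]
          refine add_le_add (hC _) ?_
          rw [← Finset.sum_filter]
          exact Finset.sum_le_sum_of_subset_of_nonneg (fun d hd => (mem_filter.1 hd).2)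
            fun d _ _ => hnn d

/-- **Mertens' first theorem** for primes congruent to `1` modulo `q`. -/
lemma exists_abs_totient_mul_sum_log_div_sub_log_le (q : ℕ) [NeZero q] : ∃ C : ℝ,
    ∀ N : ℕ, 0 < N → |q.totient * ∑ p ∈ Ioc 0 N with Nat.Prime p ∧ ((p : ℕ) : ZMod q) = 1,
      Real.log p / p - Real.log N| ≤ C := by
  classical
  obtain ⟨C₁, hC₁⟩ := exists_sum_vonMangoldt_not_prime_div_le
  obtain ⟨C₀, hC₀⟩ := exists_abs_sum_one_mul_vonMangoldt_div_sub_log_le q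
  have hex : ∀ χ : DirichletCharacter ℂ q, ∃ C : ℝ, χ ≠ 1 → ∀ N : ℕ,
      ‖∑ d ∈ Ioc 0 N, χ (d : ZMod q) * Λ d / d‖ ≤ C := fun χ => by
    by_cases h : χ = 1
    · exact ⟨0, fun h' => absurd h h'⟩
    · obtain ⟨C, hC⟩ := exists_norm_sum_character_mul_vonMangoldt_div_le h
      exact ⟨C, fun _ => hC⟩
  choose B hB using hex
  refine ⟨C₀ + ∑ χ ∈ univ.erase 1, B χ + q.totient * C₁, fun N hN => ?_⟩
  have htot : (q.totient : ℂ) ≠ 0 := mod_cast (Nat.totient_pos.mpr q.pos_of_neZero).ne'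
  have hE : (q.totient : ℂ) * ((∑ d ∈ Ioc 0 N, vonMangoldt.residueClass (1 : ZMod q) d / d : ℝ) : ℂ) =
      ∑ χ : DirichletCharacter ℂ q, ∑ d ∈ Ioc 0 N, χ (d : ZMod q) * Λ d / d := by
    rw [sum_comm]
    push_cast
    rw [mul_sum]
    refine Finset.sum_congr rfl fun d _ => ?_
    rw [vonMangoldt.residueClass_apply isUnit_one, mul_div_assoc', mul_inv_cancel_left₀ htot, sum_div]
    simp
  have hE1 : |q.totient * ∑ d ∈ Ioc 0 N, vonMangoldt.residueClass (1 : ZMod q) d / d - Real.log N| ≤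
      C₀ + ∑ χ ∈ univ.erase 1, B χ := by
    rw [← Real.norm_eq_abs, ← Complex.norm_real]
    push_cast at hE ⊢
    rw [hE, ← Finset.add_sum_erase _ _ (mem_univ (1 : DirichletCharacter ℂ q)), add_sub_right_comm]
    refine (norm_add_le _ _).trans (add_le_add ?_ ?_)
    · simpa using hC₀ N hN
    · exact (norm_sum_le _ _).trans
        (Finset.sum_le_sum fun χ hχ => hB χ (Finset.ne_of_mem_erase hχ) N)
  have hsum : ∑ d ∈ Ioc 0 N, vonMangoldt.residueClass (1 : ZMod q) d / d =
      ∑ p ∈ Ioc 0 N with Nat.Prime p ∧ ((p : ℕ) : ZMod q) = 1, Real.log p / p +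
      ∑ d ∈ Ioc 0 N, (if d.Prime then 0 else vonMangoldt.residueClass (1 : ZMod q) d) / d := by
    rw [sum_filter, ← sum_add_distrib]
    refine Finset.sum_congr rfl fun d _ => ?_
    by_cases hp : d.Prime
    · by_cases h1 : (d : ZMod q) = 1
      · simp [hp, h1, vonMangoldt.residueClass, Set.indicator, vonMangoldt_apply_prime hp]
      · simp [hp, h1, vonMangoldt.residueClass, Set.indicator]
    · simp [hp]
  have hnp : ∑ d ∈ Ioc 0 N, (if d.Prime then 0 else vonMangoldt.residueClass (1 : ZMod q) d) / d ≤ C₁ := by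
    refine le_trans (Finset.sum_le_sum fun d _ => ?_) (hC₁ (Ioc 0 N))
    split_ifs
    · exact le_rfl
    · gcongr
      exact vonMangoldt.residueClass_le _ _
  have hnn : 0 ≤ ∑ d ∈ Ioc 0 N, (if d.Prime then 0 else vonMangoldt.residueClass (1 : ZMod q) d) / d := by
    refine Finset.sum_nonneg fun d _ => ?_
    have := vonMangoldt.residueClass_nonneg (1 : ZMod q) d
    positivity
  have ht0 : (0 : ℝ) ≤ q.totient := Nat.cast_nonneg _
  rw [hsum, abs_le] at hE1
  have h1 := mul_le_mul_of_nonneg_left hnp ht0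
  have h2 := mul_nonneg ht0 hnn
  rw [abs_le]
  constructor <;> nlinarith [hE1.1, hE1.2]

/-- A Chebyshev lower bound for primes congruent to `1` modulo `q`. -/
lemma exists_mul_le_sum_log_primes (q : ℕ) [NeZero q] : ∃ c : ℝ, 0 < c ∧ ∃ N₀ : ℕ, ∀ N : ℕ,
    N₀ ≤ N → c * N ≤ ∑ p ∈ Ioc 0 N with Nat.Prime p ∧ ((p : ℕ) : ZMod q) = 1, Real.log p := by
  obtain ⟨C, hC⟩ := exists_abs_totient_mul_sum_log_div_sub_log_le q
  have htot : (0 : ℝ) < q.totient := mod_cast (Nat.totient_pos.mpr q.pos_of_neZero)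
  obtain ⟨A, hA⟩ : ∃ A : ℕ, 2 * C + 1 ≤ Real.log A ∧ 0 < A := by
    have h := (Real.tendsto_log_atTop.comp tendsto_natCast_atTop_atTop).eventually_ge_atTop
      (2 * C + 1)
    obtain ⟨A, h1, h2⟩ := (h.and (Filter.eventually_gt_atTop 0)).exists
    exact ⟨A, h1, h2⟩
  have hAr : (0 : ℝ) < A := mod_cast hA.2
  refine ⟨(q.totient : ℝ)⁻¹ / (2 * A), by positivity, A, fun N hN => ?_⟩
  set M := N / A with hM
  have hM1 : 1 ≤ M := Nat.div_pos hN hA.2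
  have hMN : M ≤ N := Nat.div_le_self _ _
  have hMr : (0 : ℝ) < M := mod_cast hM1
  have hNr : (0 : ℝ) < N := mod_cast (by omega : 0 < N)
  have h1 := (abs_le.1 (hC N (by omega))).1
  have h2 := (abs_le.1 (hC M hM1)).2
  have hlog : Real.log A ≤ Real.log N - Real.log M := by
    rw [← Real.log_div hNr.ne' hMr.ne']
    refine Real.log_le_log hAr ?_
    rw [le_div_iff₀ hMr, mul_comm]
    exact_mod_cast Nat.div_mul_le_self N A
  have hsplit : ∑ p ∈ Ioc 0 N with Nat.Prime p ∧ ((p : ℕ) : ZMod q) = 1, Real.log p / p =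
      ∑ p ∈ Ioc 0 M with Nat.Prime p ∧ ((p : ℕ) : ZMod q) = 1, Real.log p / p +
      ∑ p ∈ Ioc M N with Nat.Prime p ∧ ((p : ℕ) : ZMod q) = 1, Real.log p / p := by
    rw [← Finset.sum_union]
    · rw [← filter_union, Ioc_union_Ioc_eq_Ioc (Nat.zero_le _) hMN]
    · exact disjoint_filter_filter (Finset.disjoint_left.2 fun a ha hb => by
        simp only [mem_Ioc] at ha hb; omega)
  have hdiff : (q.totient : ℝ)⁻¹ ≤
      ∑ p ∈ Ioc M N with Nat.Prime p ∧ ((p : ℕ) : ZMod q) = 1, Real.log p / p := by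
    rw [inv_le_iff_one_le_mul₀' htot]
    rw [hsplit] at h1
    nlinarith [hA.1]
  have hup : ∑ p ∈ Ioc M N with Nat.Prime p ∧ ((p : ℕ) : ZMod q) = 1, Real.log p / p ≤
      (∑ p ∈ Ioc 0 N with Nat.Prime p ∧ ((p : ℕ) : ZMod q) = 1, Real.log p) / M := by
    rw [sum_div]
    calc _ ≤ ∑ p ∈ Ioc M N with Nat.Prime p ∧ ((p : ℕ) : ZMod q) = 1, Real.log p / M := by
          refine Finset.sum_le_sum fun p hp => ?_
          have hMp := (mem_Ioc.1 (mem_filter.1 hp).1).1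
          exact div_le_div_of_nonneg_left (Real.log_natCast_nonneg p) hMr (mod_cast hMp.le)
      _ ≤ _ := Finset.sum_le_sum_of_subset_of_nonneg
          (filter_subset_filter _ (Ioc_subset_Ioc_left (Nat.zero_le _)))
          fun p _ _ => div_nonneg (Real.log_natCast_nonneg p) hMr.le
  have h3 := hdiff.trans hup
  rw [le_div_iff₀ hMr] at h3
  refine le_trans ?_ h3
  have h4 : (N : ℝ) ≤ 2 * A * M := by
    have : N < A * (N / A) + A := by
      have := Nat.div_add_mod N A
      have := Nat.mod_lt N hA.2
      omega
    have h5 : N ≤ 2 * A * M := by nlinarith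
    exact_mod_cast h5
  rw [div_mul_eq_mul_div, div_le_iff₀ (by positivity)]
  have : (0:ℝ) ≤ (q.totient : ℝ)⁻¹ := by positivity
  nlinarith

/-- A nonzero integer of size at most `r` is not divisible by some prime `p ≡ 1 (mod q)` of size
`O(log r)`. -/
lemma exists_prime_modEq_one_not_dvd (q : ℕ) [NeZero q] : ∃ C : ℝ, 0 < C ∧ ∀ (a : ℤ) (r : ℝ),
    a ≠ 0 → 2 ≤ r → |(a : ℝ)| ≤ r →
      ∃ p : ℕ, p.Prime ∧ (p : ZMod q) = 1 ∧ ¬ (p : ℤ) ∣ a ∧ (p : ℝ) ≤ C * Real.log r := by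
  obtain ⟨c, hc, N₀, hN₀⟩ := exists_mul_le_sum_log_primes q
  refine ⟨2 / c + (N₀ + 1) / Real.log 2, by positivity, fun a r ha hr har => ?_⟩
  have hlog2 : 0 < Real.log 2 := Real.log_pos (by norm_num)
  have hlogr : Real.log 2 ≤ Real.log r := Real.log_le_log (by norm_num) hr
  set N := ⌊(2 / c + (N₀ + 1) / Real.log 2) * Real.log r⌋₊ with hN
  have hx0 : 0 ≤ (2 / c + (N₀ + 1) / Real.log 2) * Real.log r := by
    have : 0 ≤ Real.log r := by linarith
    positivity
  have hN1 : 2 / c * Real.log r + (N₀ + 1) ≤ (2 / c + (N₀ + 1) / Real.log 2) * Real.log r := by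
    rw [add_mul]
    gcongr
    rw [div_mul_eq_mul_div, le_div_iff₀ hlog2]
    gcongr
  have hNlt : (2 / c + (N₀ + 1) / Real.log 2) * Real.log r < N + 1 := Nat.lt_floor_add_one _
  have hpos : 0 < 2 / c * Real.log r := by
    have : 0 < Real.log r := by linarith
    positivity
  have hNN₀ : N₀ ≤ N := by
    have : (N₀ : ℝ) < N + 1 := by linarith
    have : N₀ < N + 1 := by exact_mod_cast this
    omega
  by_contra hcon
  push Not at hcon
  have hall : ∀ p ∈ (Ioc 0 N).filter (fun p => Nat.Prime p ∧ ((p : ℕ) : ZMod q) = 1), p ∣ a.natAbs := by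
    intro p hp
    obtain ⟨h1, h2, h3⟩ := mem_filter.1 hp
    by_contra h
    refine absurd (hcon p h2 h3 (fun h' => h (Int.natCast_dvd.1 h'))) (not_lt.2 ?_)
    exact (Nat.cast_le.2 (mem_Ioc.1 h1).2).trans (Nat.floor_le hx0)
  have hprod : ∏ p ∈ Ioc 0 N with Nat.Prime p ∧ ((p : ℕ) : ZMod q) = 1, p ∣ a.natAbs := by
    refine Finset.prod_primes_dvd _ (fun p hp => (mem_filter.1 hp).2.1.prime) hall
  have hle := Nat.le_of_dvd (Int.natAbs_pos.2 ha) hprod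
  have hle' : ((∏ p ∈ Ioc 0 N with Nat.Prime p ∧ ((p : ℕ) : ZMod q) = 1, p : ℕ) : ℝ) ≤ r := by
    refine le_trans (Nat.cast_le.2 hle) ?_
    rw [Nat.cast_natAbs, Int.cast_abs]
    exact har
  have hl := hN₀ N hNN₀
  have hlogprod : ∑ p ∈ Ioc 0 N with Nat.Prime p ∧ ((p : ℕ) : ZMod q) = 1, Real.log p ≤ Real.log r := by
    have hne : ∀ p ∈ (Ioc 0 N).filter (fun p => Nat.Prime p ∧ ((p : ℕ) : ZMod q) = 1),
        (p : ℝ) ≠ 0 := fun p hp => Nat.cast_ne_zero.2 (mem_filter.1 hp).2.1.ne_zero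
    rw [← Real.log_prod hne, ← Nat.cast_prod]
    refine Real.log_le_log ?_ hle'
    exact Nat.cast_pos.2 (Finset.prod_pos fun p hp => (mem_filter.1 hp).2.1.pos)
  have hNbig : 2 / c * Real.log r ≤ N := by
    have : (0 : ℝ) ≤ N₀ := Nat.cast_nonneg _
    linarith
  have := mul_le_mul_of_nonneg_left hNbig hc.le
  have e : c * (2 / c * Real.log r) = 2 * Real.log r := by field_simp
  linarith

end

section Capelli
open Equiv

/-- The Capelli polynomial in three families of noncommuting variables, alternating in the
second one. -/
def capelli {R : Type*} [Ring R] {N : ℕ} (u x v : Fin N → R) : R :=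
  ∑ σ : Perm (Fin N), Perm.sign σ • (List.ofFn fun i => u i * x (σ i) * v i).prod

lemma map_capelli {R R' : Type*} [Ring R] [Ring R'] (f : R →+* R') {N : ℕ} (u x v : Fin N → R) :
    f (capelli u x v) = capelli (f ∘ u) (f ∘ x) (f ∘ v) := by
  simp only [capelli, map_sum, Units.smul_def, map_zsmul, map_list_prod, List.map_ofFn,
    Function.comp_def, map_mul]

lemma capelli_mem {R : Type*} [Ring R] (T : Subring R) {N : ℕ} {u x v : Fin N → R}
    (hu : ∀ i, u i ∈ T) (hx : ∀ i, x i ∈ T) (hv : ∀ i, v i ∈ T) : capelli u x v ∈ T := by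
  refine sum_mem fun σ _ => ?_
  rw [Units.smul_def]
  refine zsmul_mem (list_prod_mem fun y hy => ?_) _
  obtain ⟨i, rfl⟩ := List.mem_ofFn.1 hy
  exact mul_mem (mul_mem (hu i) (hx _)) (hv i)

/-- A semiconjugacy between two families of additive endomorphisms passes to their Capelli
polynomials. -/
lemma capelli_semiconj {M M' : Type*} [AddCommGroup M] [AddCommGroup M'] (T : M →+ M')
    {N : ℕ} {u x v : Fin N → AddMonoid.End M} {u' x' v' : Fin N → AddMonoid.End M'}
    (hu : ∀ i a, T (u i a) = u' i (T a)) (hx : ∀ i a, T (x i a) = x' i (T a))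
    (hv : ∀ i a, T (v i a) = v' i (T a)) (a : M) :
    T (capelli u x v a) = capelli u' x' v' (T a) := by
  let P : Subring (AddMonoid.End M × AddMonoid.End M') :=
    { carrier := {q | ∀ a, T (q.1 a) = q.2 (T a)}
      mul_mem' := fun {p q} hp hq a => by
        change T (p.1 (q.1 a)) = p.2 (q.2 (T a))
        rw [hp, hq]
      one_mem' := fun a => rfl
      add_mem' := fun {p q} hp hq a => by
        change T (p.1 a + q.1 a) = p.2 (T a) + q.2 (T a)
        rw [map_add, hp, hq]
      zero_mem' := fun a => map_zero T
      neg_mem' := fun {p} hp a => by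
        change T (-p.1 a) = -p.2 (T a)
        rw [map_neg, hp] }
  have h := capelli_mem P (u := fun i => (u i, u' i)) (x := fun i => (x i, x' i))
    (v := fun i => (v i, v' i)) (fun i => hu i) (fun i => hx i) (fun i => hv i)
  have h1 := map_capelli (RingHom.fst (AddMonoid.End M) (AddMonoid.End M'))
    (fun i => (u i, u' i)) (fun i => (x i, x' i)) (fun i => (v i, v' i))
  have h2 := map_capelli (RingHom.snd (AddMonoid.End M) (AddMonoid.End M'))
    (fun i => (u i, u' i)) (fun i => (x i, x' i)) (fun i => (v i, v' i))
  have h3 := h a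
  simp only [RingHom.coe_fst, RingHom.coe_snd] at h1 h2
  rw [h1, h2] at h3
  exact h3

lemma capelli_eq_zero_of_finrank_lt (F : Type*) {R : Type*} [CommRing F] [IsDomain F] [Ring R]
    [Algebra F R] [Module.IsTorsionFree F R] [Module.Finite F R] {N : ℕ}
    (h : Module.finrank F R < N) (u x v : Fin N → R) : capelli u x v = 0 := by
  let f : R [⋀^Fin N]→ₗ[F] R := MultilinearMap.alternatization
    ((MultilinearMap.mkPiAlgebraFin F N R).compLinearMap
      fun i => (LinearMap.mulRight F (v i)).comp (LinearMap.mulLeft F (u i)))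
  have hf : capelli u x v = f x := by
    simp [f, capelli, MultilinearMap.alternatization_apply]
  rw [hf]
  refine f.map_linearDependent x fun hx => ?_
  have := hx.fintype_card_le_finrank
  simp at this
  omega

lemma MultilinearMap.eq_zero_of_span_eq_top {F R M : Type*} [Field F] [AddCommGroup R]
    [Module F R] [AddCommGroup M] [Module F M] {N : ℕ} (f : MultilinearMap F (fun _ : Fin N => R) M)
    {S : Set R} (hS : Submodule.span F S = ⊤) (h : ∀ x : Fin N → R, (∀ i, x i ∈ S) → f x = 0) :
    f = 0 := by
  obtain ⟨b, hbS, hb, hli⟩ := exists_linearIndependent F S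
  let B : Module.Basis b F R := .mk hli (by rw [Subtype.range_coe, hb, hS])
  refine Module.Basis.ext_multilinear (fun _ => B) fun y => ?_
  simp only [zero_apply]
  refine h _ fun i => ?_
  simp only [B, Module.Basis.mk_apply]
  exact hbS (y i).2

lemma capelli_eq_zero_of_span_eq_top (F : Type*) {R : Type*} [Field F] [Ring R] [Algebra F R]
    {N : ℕ} {S : Set R} (hS : Submodule.span F S = ⊤)
    (h : ∀ u x v : Fin N → R, (∀ i, u i ∈ S) → (∀ i, x i ∈ S) → (∀ i, v i ∈ S) →
      capelli u x v = 0) (u x v : Fin N → R) : capelli u x v = 0 := by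
  have hx : ∀ u x v : Fin N → R, (∀ i, u i ∈ S) → (∀ i, v i ∈ S) → capelli u x v = 0 := by
    intro u x v hu hv
    let f : MultilinearMap F (fun _ : Fin N => R) R := ∑ σ : Perm (Fin N), Perm.sign σ •
      ((MultilinearMap.mkPiAlgebraFin F N R).compLinearMap
        fun i => (LinearMap.mulRight F (v i)).comp (LinearMap.mulLeft F (u i))).domDomCongr σ
    have hf : ∀ x, f x = capelli u x v := fun x => by
      simp [f, capelli]
    rw [← hf, MultilinearMap.eq_zero_of_span_eq_top f hS fun x hx => (hf x).trans (h u x v hu hx hv),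
      zero_apply]
  have hxv : ∀ u x v : Fin N → R, (∀ i, u i ∈ S) → capelli u x v = 0 := by
    intro u x v hu
    let f : MultilinearMap F (fun _ : Fin N => R) R := ∑ σ : Perm (Fin N), Perm.sign σ •
      (MultilinearMap.mkPiAlgebraFin F N R).compLinearMap
        fun i => LinearMap.mulLeft F (u i * x (σ i))
    have hf : ∀ v, f v = capelli u x v := fun x => by
      simp [f, capelli, mul_assoc]
    rw [← hf, MultilinearMap.eq_zero_of_span_eq_top f hS fun v hv => (hf v).trans (hx u x v hu hv),
      zero_apply]
  let f : MultilinearMap F (fun _ : Fin N => R) R := ∑ σ : Perm (Fin N), Perm.sign σ •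
    (MultilinearMap.mkPiAlgebraFin F N R).compLinearMap
      fun i => LinearMap.mulRight F (x (σ i) * v i)
  have hf : ∀ u, f u = capelli u x v := fun x => by
    simp [f, capelli, mul_assoc]
  rw [← hf, MultilinearMap.eq_zero_of_span_eq_top f hS fun u hu => (hf u).trans (hxv u x v hu),
    zero_apply]

lemma exists_capelli_matrix_ne_zero (F : Type*) [Field F] {N d : ℕ} (hd : 0 < d)
    (h : N ≤ d ^ 2) : ∃ u x v : Fin N → Matrix (Fin d) (Fin d) F, capelli u x v ≠ 0 := by
  classical
  obtain ⟨f⟩ : Nonempty (Fin N ↪ Fin d × Fin d) :=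
    Function.Embedding.nonempty_of_card_le (by simpa [← sq] using h)
  let o : Fin d := ⟨0, hd⟩
  let u : Fin N → Matrix (Fin d) (Fin d) F := fun i => Matrix.single o (f i).1 1
  let x : Fin N → Matrix (Fin d) (Fin d) F := fun i => Matrix.single (f i).1 (f i).2 1
  let v : Fin N → Matrix (Fin d) (Fin d) F := fun i => Matrix.single (f i).2 o 1
  have hc : ∀ i j, u i * x j * v i = if i = j then Matrix.single o o 1 else 0 := by
    intro i j
    split_ifs with hij
    · subst hij
      simp [u, x, v]
    · have : ¬((f i).1 = (f j).1 ∧ (f i).2 = (f j).2) := fun hh =>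
        hij (f.injective (Prod.ext hh.1 hh.2))
      by_cases h1 : (f i).1 = (f j).1
      · have h2 : (f j).2 ≠ (f i).2 := fun h2 => this ⟨h1, h2.symm⟩
        simp [u, x, v, h1, Matrix.single_mul_single_of_ne, h2]
      · simp [u, x, v, Matrix.single_mul_single_of_ne, h1]
  let φ : Matrix (Fin d) (Fin d) F := Matrix.single o o 1
  have hφ : ∀ n : ℕ, 0 < n → φ ^ n = φ := by
    intro n hn
    exact (IsIdempotentElem.pow_eq (a := φ) (by simp [IsIdempotentElem, φ]) hn.ne')
  have hφ0 : φ ≠ 0 := fun h0 => by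
    have := congrFun (congrFun h0 o) o
    simp [φ] at this
  have h1 : (1 : Matrix (Fin d) (Fin d) F) ≠ 0 := fun h0 => hφ0 (by
    rw [← mul_one φ, h0, mul_zero])
  refine ⟨u, x, v, ?_⟩
  have : capelli u x v = φ ^ N := by
    unfold capelli
    rw [Finset.sum_eq_single 1]
    · simp [hc, List.ofFn_const, φ]
    · intro σ _ hσ
      obtain ⟨i, hi⟩ : ∃ i, σ i ≠ i := by
        by_contra! hh
        exact hσ (Equiv.ext hh)
      rw [List.prod_eq_zero, smul_zero]
      rw [List.mem_ofFn]
      exact ⟨i, by simp only [hc, if_neg hi.symm]⟩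
    · simp
  rw [this]
  rcases Nat.eq_zero_or_pos N with rfl | hN
  · simpa using h1
  · rwa [hφ N hN]

lemma exists_capelli_ne_zero {F V : Type*} [Field F] [AddCommGroup V] [Module F V]
    [Module.Finite F V] {N : ℕ} (hd : 0 < Module.finrank F V) (h : N ≤ Module.finrank F V ^ 2)
    {S : Set (Module.End F V)} (hS : Submodule.span F S = ⊤) :
    ∃ u x v : Fin N → Module.End F V, (∀ i, u i ∈ S) ∧ (∀ i, x i ∈ S) ∧ (∀ i, v i ∈ S) ∧
      capelli u x v ≠ 0 := by
  by_contra! hcon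
  obtain ⟨u, x, v, huxv⟩ := exists_capelli_matrix_ne_zero F hd h
  let φ := (LinearMap.toMatrixAlgEquiv (Module.finBasis F V)).symm
  have := map_capelli (φ : _ →+* Module.End F V) u x v
  rw [capelli_eq_zero_of_span_eq_top F hS hcon] at this
  exact huxv (φ.injective (by simpa using this))

end Capelli

section Burnside
open Module

/-- No proper nonzero subspace is stable under `S`. -/
def ActsIrreducibly {F V : Type*} [Field F] [AddCommGroup V] [Module F V]
    (S : Set (End F V)) : Prop :=
  ∀ W : Submodule F V, (∀ s ∈ S, ∀ v ∈ W, s v ∈ W) → W = ⊥ ∨ W = ⊤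

lemma ActsIrreducibly.isSimpleModule {F V : Type*} [Field F] [AddCommGroup V] [Module F V]
    [Nontrivial V] {S : Set (End F V)} (hS : ActsIrreducibly S) :
    IsSimpleModule (Algebra.adjoin F S) V := by
  rw [isSimpleModule_iff]
  refine ⟨fun W => ?_⟩
  rcases hS (W.restrictScalars F) fun s hs v hv =>
    W.smul_mem (⟨s, Algebra.subset_adjoin hs⟩ : Algebra.adjoin F S) hv with h | h
  · exact Or.inl (by simpa using h)
  · exact Or.inr (by simpa using h)

/-- The `F`-linear map underlying an endomorphism of `V` over an algebra of operators. -/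
lemma commute_of_end_adjoin {F V : Type*} [Field F] [AddCommGroup V] [Module F V]
    {S : Set (End F V)} (φ : End (Algebra.adjoin F S) V) {s : End F V} (hs : s ∈ S) (v : V) :
    φ (s v) = s (φ v) :=
  φ.map_smul (⟨s, Algebra.subset_adjoin hs⟩ : Algebra.adjoin F S) v

lemma span_eq_top_of_commute_scalar {F V : Type*} [Field F] [AddCommGroup V] [Module F V]
    [Module.Finite F V] [Nontrivial V] (S : Submonoid (End F V))
    (hS : ActsIrreducibly (S : Set (End F V)))
    (hc : ∀ f : End F V, (∀ s ∈ S, Commute f s) → ∃ c : F, f = c • 1) :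
    Submodule.span F (S : Set (End F V)) = ⊤ := by
  have := hS.isSimpleModule
  rw [eq_top_iff]
  intro f _
  let f' : End (End (Algebra.adjoin F (S : Set (End F V))) V) V :=
    { toFun := f
      map_add' := f.map_add
      map_smul' := fun φ v => by
        obtain ⟨c, hφ⟩ := hc (φ.restrictScalars F) fun s hs =>
          LinearMap.ext fun v => commute_of_end_adjoin φ hs v
        have hφ' : ∀ w, φ w = c • w := fun w => congrArg (fun g : End F V => g w) hφ
        simp only [RingHom.id_apply, End.smul_def, hφ', map_smul] }
  classical
  obtain ⟨r, hr⟩ := jacobson_density f' (Finset.univ.image (finBasis F V))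
  have hfr : f = r.1 := (finBasis F V).ext fun i => hr _ (by simp)
  have h2 := r.2
  rwa [← hfr, ← Subalgebra.mem_toSubmodule, Algebra.adjoin_eq_span, Submonoid.closure_eq] at h2

lemma span_eq_top_of_isAlgClosed {F V : Type*} [Field F] [IsAlgClosed F] [AddCommGroup V]
    [Module F V] [Module.Finite F V] [Nontrivial V] (S : Submonoid (End F V))
    (hS : ActsIrreducibly (S : Set (End F V))) :
    Submodule.span F (S : Set (End F V)) = ⊤ := by
  refine span_eq_top_of_commute_scalar S hS fun f hf => ?_
  obtain ⟨c, hcf⟩ := End.exists_eigenvalue f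
  refine ⟨c, ?_⟩
  have := (hS (End.eigenspace f c) fun s hs v hv => ?_).resolve_left hcf
  · ext v
    have hv : v ∈ End.eigenspace f c := this ▸ Submodule.mem_top
    simpa using End.mem_eigenspace_iff.1 hv
  · rw [End.mem_eigenspace_iff] at hv ⊢
    have := congrArg (fun g : End F V => g v) (hf s hs)
    simp only [End.mul_apply, hv, map_smul] at this
    exact this

lemma Matrix.trace_pow_char_of_pow_eq_self {D n : Type*} [Field D] (p : ℕ) [Fact p.Prime]
    [CharP D p] [Fintype n] [DecidableEq n] {M : Matrix n n D} (hM : M ^ p = M) :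
    M.trace ^ p = M.trace := by
  let E := AlgebraicClosure D
  have : CharP E p := charP_of_injective_algebraMap (algebraMap D E).injective p
  let M' : Matrix n n E := M.map (algebraMap D E)
  have hM' : M' ^ p = M' := by
    have := congrArg (algebraMap D E).mapMatrix hM
    rwa [map_pow] at this
  have htr : algebraMap D E M.trace = M'.trace := by
    simp [M', Matrix.trace]
  apply (algebraMap D E).injective
  rw [map_pow, htr, Matrix.trace_eq_sum_roots_charpoly, ← frobenius_def, map_multiset_sum]
  congr 1
  conv_rhs => rw [← Multiset.map_id M'.charpoly.roots]
  refine Multiset.map_congr rfl fun r hr => ?_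
  have hr' : End.HasEigenvalue (Matrix.toLin' M') r := by
    rw [End.hasEigenvalue_iff_isRoot_charpoly, Matrix.charpoly_toLin']
    exact (Polynomial.mem_roots'.1 hr).2
  obtain ⟨v, hv⟩ := hr'.exists_hasEigenvector
  have h1 := hv.pow_apply p
  rw [← Matrix.toLin'_pow, hM', hv.apply_eq_smul] at h1
  simpa [frobenius_def] using (smul_left_injective E hv.2 h1).symm

lemma LinearMap.exists_trace_eq {D V : Type*} [Field D] [AddCommGroup V] [Module D V]
    [Module.Finite D V] [Nontrivial V] (c : D) : ∃ f : End D V, LinearMap.trace D V f = c := by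
  have : Nonempty (Fin (finrank D V)) := ⟨⟨0, finrank_pos⟩⟩
  obtain ⟨M, hM⟩ := Matrix.trace_surjective (n := Fin (finrank D V)) c
  refine ⟨Matrix.toLin (finBasis D V) (finBasis D V) M, ?_⟩
  rw [LinearMap.trace_eq_matrix_trace D (finBasis D V), LinearMap.toMatrix_toLin, hM]

lemma LinearMap.trace_pow_char_of_pow_eq_self {D V : Type*} [Field D] (p : ℕ) [Fact p.Prime]
    [CharP D p] [AddCommGroup V] [Module D V] [Module.Finite D V] {f : End D V} (hf : f ^ p = f) :
    LinearMap.trace D V f ^ p = LinearMap.trace D V f := by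
  rw [LinearMap.trace_eq_matrix_trace D (finBasis D V)]
  refine Matrix.trace_pow_char_of_pow_eq_self p ?_
  rw [LinearMap.toMatrix_pow, hf]

lemma mem_bot_of_addSubgroupClosure_eq_top {D V : Type*} [Field D] (p : ℕ) [Fact p.Prime]
    [CharP D p] [AddCommGroup V] [Module D V] [Module.Finite D V] [Nontrivial V]
    {S : Set (End D V)} (hp : ∀ s ∈ S, s ^ p = s) (hS : AddSubgroup.closure S = ⊤) (c : D) :
    c ∈ (⊥ : Subfield D) := by
  obtain ⟨f, rfl⟩ := LinearMap.exists_trace_eq (V := V) c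
  have hf : f ∈ AddSubgroup.closure S := hS ▸ AddSubgroup.mem_top f
  induction hf using AddSubgroup.closure_induction with
  | mem s hs =>
    rw [Subfield.mem_bot_iff_pow_eq_self D p]
    exact LinearMap.trace_pow_char_of_pow_eq_self p (hp s hs)
  | zero => rw [map_zero]; exact zero_mem _
  | add x y _ _ hx hy => rw [map_add]; exact add_mem hx hy
  | neg x _ hx => rw [map_neg]; exact neg_mem hx

lemma ZMod.span_le_addSubgroupClosure {p : ℕ} [NeZero p] {V : Type*} [AddCommGroup V]
    [Module (ZMod p) V] (S : Set V) {x : V} (hx : x ∈ Submodule.span (ZMod p) S) :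
    x ∈ AddSubgroup.closure S := by
  induction hx using Submodule.span_induction with
  | mem s hs => exact AddSubgroup.subset_closure hs
  | zero => exact zero_mem _
  | add x y _ _ hx hy => exact add_mem hx hy
  | smul c x _ hx =>
    rw [← ZMod.natCast_zmod_val c, Nat.cast_smul_eq_nsmul]
    exact nsmul_mem hx _

lemma mem_span_of_mem_adjoin {F V : Type*} [Field F] [AddCommGroup V] [Module F V]
    {S : Submonoid (End F V)} {a : End F V}
    (ha : a ∈ Algebra.adjoin F (S : Set (End F V))) :
    a ∈ Submodule.span F (S : Set (End F V)) := by
  rwa [← Subalgebra.mem_toSubmodule, Algebra.adjoin_eq_span, Submonoid.closure_eq] at ha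

lemma commute_of_mem_adjoin {F V : Type*} [Field F] [AddCommGroup V] [Module F V]
    {S : Set (End F V)} {f a : End F V} (hf : ∀ s ∈ S, Commute f s)
    (ha : a ∈ Algebra.adjoin F S) : Commute f a := by
  induction ha using Algebra.adjoin_induction with
  | mem s hs => exact hf s hs
  | algebraMap r => exact (Algebra.commutes r f).symm
  | add x y _ _ hx hy => exact hx.add_right hy
  | mul x y _ _ hx hy => exact hx.mul_right hy

lemma span_eq_top_of_pow_eq_self {p : ℕ} [Fact p.Prime] {V : Type*} [AddCommGroup V]
    [Module (ZMod p) V] [Module.Finite (ZMod p) V] [Nontrivial V] (S : Submonoid (End (ZMod p) V))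
    (hS : ActsIrreducibly (S : Set (End (ZMod p) V))) (hp : ∀ s ∈ S, s ^ p = s) :
    Submodule.span (ZMod p) (S : Set (End (ZMod p) V)) = ⊤ := by
  classical
  refine span_eq_top_of_commute_scalar S hS fun f hf => ?_
  let A := Algebra.adjoin (ZMod p) (S : Set (End (ZMod p) V))
  have : IsSimpleModule A V := hS.isSimpleModule
  have : Finite V := Module.finite_of_finite (ZMod p)
  have : Finite (End A V) := DFunLike.finite (End A V)
  have hchar : CharP (End A V) p :=
    charP_of_injective_ringHom (algebraMap (ZMod p) (End A V)).injective p
  let S' : Set (End (End A V) V) := {T | ∃ s ∈ S, ∀ v, T v = s v}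
  have hS'p : ∀ T ∈ S', T ^ p = T := by
    rintro T ⟨s, hs, hT⟩
    have hpow : ∀ n : ℕ, ∀ v, (T ^ n) v = (s ^ n) v := fun n => by
      induction n with
      | zero => simp
      | succ n ih => intro v; rw [pow_succ, pow_succ, End.mul_apply, End.mul_apply, ih, hT]
    ext v
    rw [hpow, hp s hs, hT]
  have hS'top : AddSubgroup.closure S' = ⊤ := by
    rw [eq_top_iff]
    intro T _
    obtain ⟨a, rfl⟩ := Module.Finite.toModuleEnd_moduleEnd_surjective (R := A) (M := V) T
    have ha := ZMod.span_le_addSubgroupClosure _ (mem_span_of_mem_adjoin a.2)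
    suffices ∀ x ∈ AddSubgroup.closure (S : Set (End (ZMod p) V)), ∀ hx : x ∈ A,
      Module.toModuleEnd (End A V) V (⟨x, hx⟩ : A) ∈ AddSubgroup.closure S' from this _ ha a.2
    intro x hx
    induction hx using AddSubgroup.closure_induction with
    | mem s hs => exact fun hx => AddSubgroup.subset_closure ⟨s, hs, fun v => rfl⟩
    | zero => exact fun hx => (map_zero (Module.toModuleEnd (End A V) (S := A) V)) ▸ zero_mem _
    | add x y hx' hy' hx hy =>
      intro hxy
      have hA : ∀ x ∈ AddSubgroup.closure (S : Set (End (ZMod p) V)), x ∈ A := fun x hx =>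
        (AddSubgroup.closure_le A.toSubring.toAddSubgroup).2
          (fun _ h => Algebra.subset_adjoin h) hx
      have := add_mem (hx (hA x hx')) (hy (hA y hy'))
      rwa [← map_add] at this
    | neg x hx' hx =>
      intro hnx
      have := neg_mem (hx (neg_neg x ▸ neg_mem hnx))
      rwa [← map_neg] at this
  let φ : End A V :=
    { toFun := f
      map_add' := f.map_add
      map_smul' := fun a v => congrArg (fun g : End (ZMod p) V => g v)
        (commute_of_mem_adjoin hf a.2) }
  have hφ : ∃ c : ZMod p, φ = algebraMap (ZMod p) (End A V) c := by
    let _ : Field (End A V) := littleWedderburn (End A V)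
    have hφ := mem_bot_of_addSubgroupClosure_eq_top p hS'p hS'top φ
    rw [← ZMod.fieldRange_castHom_eq_bot p] at hφ
    obtain ⟨c, hc⟩ := hφ
    refine ⟨c, hc.symm.trans ?_⟩
    exact congrArg (fun g : ZMod p →+* End A V => g c) (Subsingleton.elim _ _)
  obtain ⟨c, hc⟩ := hφ
  exact ⟨c, LinearMap.ext fun v => congrArg (fun g : End A V => g v) hc⟩

end Burnside

section Reps
open Module

variable {F Γ V : Type*} [Field F] [Group Γ] [Finite Γ] [NeZero (Nat.card Γ : F)] [AddCommGroup V]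
  [Module F V] (ρ : Representation F Γ V)

open Subrepresentation in
lemma Representation.induction_on_irreducible {P : V → Prop} (h0 : P 0)
    (hadd : ∀ v w, P v → P w → P (v + w))
    (h : ∀ W : Submodule F V, W ≠ ⊥ → (∀ g, ∀ v ∈ W, ρ g v ∈ W) →
      (∀ W' ≤ W, W' ≠ ⊥ → (∀ g, ∀ v ∈ W', ρ g v ∈ W') → W' = W) → ∀ v ∈ W, P v) (v : V) :
    P v := by
  have htop := IsSemisimpleModule.sSup_simples_eq_top (MonoidAlgebra F Γ) ρ.asModule
  rw [sSup_eq_iSup'] at htop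
  have hv : ρ.asModuleEquiv.symm v ∈ (⊤ : Submodule (MonoidAlgebra F Γ) ρ.asModule) := Submodule.mem_top
  rw [← htop] at hv
  suffices ∀ w : ρ.asModule, w ∈ (⨆ a : {W : Submodule (MonoidAlgebra F Γ) ρ.asModule |
      IsSimpleModule (MonoidAlgebra F Γ) W}, (a : Submodule (MonoidAlgebra F Γ) ρ.asModule)) →
      P (ρ.asModuleEquiv w) by simpa using this _ hv
  intro w hw
  refine Submodule.iSup_induction _ (motive := fun w => P (ρ.asModuleEquiv w)) hw ?_
    (by simpa using h0) fun x y hx hy => by simpa using hadd _ _ hx hy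
  rintro ⟨W, hW⟩ x hx
  have hatom : IsAtom W := isSimpleModule_iff_isAtom.1 hW
  have hatom' : IsAtom (ofSubmodule' W) :=
    ((subrepresentationSubmoduleOrderIso (ρ := ρ)).symm.isAtom_iff W).2 hatom
  refine h (ofSubmodule' W).toSubmodule ?_ (fun g v hv => (ofSubmodule' W).apply_mem_toSubmodule g hv)
    ?_ _ hx
  · intro hbot
    exact hatom'.1 (toSubmodule_injective hbot)
  · intro W' hle hne hinv
    let σ : Subrepresentation ρ := ⟨W', fun g v hv => hinv g v hv⟩
    have hσ : σ ≤ ofSubmodule' W := hle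
    have : σ = ofSubmodule' W := (hatom'.le_iff.1 hσ).resolve_left fun hb =>
      hne (congrArg toSubmodule hb)
    exact congrArg toSubmodule this

open Subrepresentation in
lemma Representation.exists_maximal_notMem {v : V} (hv : v ≠ 0) :
    ∃ M : Submodule F V, v ∉ M ∧ (∀ g, ∀ w ∈ M, ρ g w ∈ M) ∧
      ∀ M' ≥ M, (∀ g, ∀ w ∈ M', ρ g w ∈ M') → M' = M ∨ M' = ⊤ := by
  have hj := IsSemisimpleModule.jacobson_eq_bot (MonoidAlgebra F Γ) ρ.asModule
  have hv' : ρ.asModuleEquiv.symm v ∉ Module.jacobson (MonoidAlgebra F Γ) ρ.asModule := by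
    rw [hj]
    simpa using hv
  rw [Module.jacobson, Submodule.mem_sInf] at hv'
  push Not at hv'
  obtain ⟨M, hM, hvM⟩ := hv'
  have hco : IsCoatom (ofSubmodule' M) :=
    ((subrepresentationSubmoduleOrderIso (ρ := ρ)).symm.isCoatom_iff M).2 hM
  refine ⟨(ofSubmodule' M).toSubmodule, hvM,
    fun g v hv => (ofSubmodule' M).apply_mem_toSubmodule g hv, fun M' hle hinv => ?_⟩
  let σ : Subrepresentation ρ := ⟨M', fun g v hv => hinv g v hv⟩
  have hσ : ofSubmodule' M ≤ σ := hle
  rcases hco.le_iff.1 hσ with h | h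
  · exact Or.inr (congrArg toSubmodule h)
  · exact Or.inl (congrArg toSubmodule h)

end Reps

section Reduction
open Module

lemma capelli_semiconj_end {F F' V V' : Type*} [CommRing F] [CommRing F'] [AddCommGroup V]
    [AddCommGroup V'] [Module F V] [Module F' V'] (T : V →+ V') {N : ℕ}
    {u x v : Fin N → End F V} {u' x' v' : Fin N → End F' V'}
    (hu : ∀ i a, T (u i a) = u' i (T a)) (hx : ∀ i a, T (x i a) = x' i (T a))
    (hv : ∀ i a, T (v i a) = v' i (T a)) (a : V) :
    T (capelli u x v a) = capelli u' x' v' (T a) := by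
  have h1 := map_capelli (Module.toAddMonoidEnd (End F V) V) u x v
  have h2 := map_capelli (Module.toAddMonoidEnd (End F' V') V') u' x' v'
  have h3 := capelli_semiconj T (u := Module.toAddMonoidEnd (End F V) V ∘ u)
    (x := Module.toAddMonoidEnd (End F V) V ∘ x) (v := Module.toAddMonoidEnd (End F V) V ∘ v)
    (u' := Module.toAddMonoidEnd (End F' V') V' ∘ u')
    (x' := Module.toAddMonoidEnd (End F' V') V' ∘ x')
    (v' := Module.toAddMonoidEnd (End F' V') V' ∘ v') hu hx hv a
  rw [← h1, ← h2] at h3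
  exact h3

variable {m : ℕ}

/-- The action of integer matrices on `F^m`. -/
noncomputable def intEnd (F : Type*) [CommRing F] (m : ℕ) :
    Matrix (Fin m) (Fin m) ℤ →+* End F (Fin m → F) :=
  (Matrix.toLinAlgEquiv' (R := F) (n := Fin m)).toRingEquiv.toRingHom.comp
    (Int.castRingHom F).mapMatrix

lemma intEnd_apply (F : Type*) [CommRing F] (M : Matrix (Fin m) (Fin m) ℤ) (v : Fin m → F) :
    intEnd F m M v = (M.map (Int.cast : ℤ → F)).mulVec v := rfl

/-- The natural representation of `GL(m, ℤ)` on `F^m`. -/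
noncomputable def intRep (F : Type*) [CommRing F] (m : ℕ) :
    Representation F (Matrix.GeneralLinearGroup (Fin m) ℤ) (Fin m → F) :=
  (intEnd F m : _ →* End F (Fin m → F)).comp (Units.coeHom (Matrix (Fin m) (Fin m) ℤ))

lemma intRep_apply (F : Type*) [CommRing F] (g : Matrix.GeneralLinearGroup (Fin m) ℤ)
    (v : Fin m → F) :
    intRep F m g v = ((g : Matrix (Fin m) (Fin m) ℤ).map (Int.cast : ℤ → F)).mulVec v := rfl

lemma map_mulVec_intCast (F : Type*) [CommRing F] (M : Matrix (Fin m) (Fin m) ℤ) (v : Fin m → ℤ) :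
    (fun i => ((M.mulVec v i : ℤ) : F)) = (M.map (Int.cast : ℤ → F)).mulVec (fun i => (v i : F)) := by
  ext i
  simp [Matrix.mulVec, dotProduct]

/-- If every irreducible complex constituent of `Γ` has dimension at most `k`, then the Capelli
polynomial of degree `k² + 1` in the middle variables vanishes on `Γ`. -/
lemma capelli_eq_zero_of_irred_le (Γ : Subgroup (Matrix.GeneralLinearGroup (Fin m) ℤ)) [Finite Γ]
    {k : ℕ} (hk : ∀ W : Submodule ℂ (Fin m → ℂ),
      IsIrredC (fun g : Γ => (g.1 : Matrix (Fin m) (Fin m) ℤ)) W → finrank ℂ W ≤ k)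
    (u x v : Fin (k ^ 2 + 1) → Γ) :
    capelli (fun i => (u i).1.1) (fun i => (x i).1.1) (fun i => (v i).1.1) = 0 := by
  let ρ : Representation ℂ Γ (Fin m → ℂ) := (intRep ℂ m).comp Γ.subtype
  have h1 := map_capelli (intEnd ℂ m)
    (fun i => (u i).1.1) (fun i => (x i).1.1) (fun i => (v i).1.1)
  have hinj : Function.Injective (intEnd ℂ m) :=
    (Matrix.toLinAlgEquiv' (R := ℂ)).injective.comp
      (Matrix.map_injective (RingHom.injective_int (Int.castRingHom ℂ)))
  apply hinj
  rw [h1, map_zero]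
  refine LinearMap.ext fun w => ?_
  change capelli (ρ ∘ u) (ρ ∘ x) (ρ ∘ v) w = 0
  have : NeZero (Nat.card Γ : ℂ) := ⟨Nat.cast_ne_zero.2 Nat.card_pos.ne'⟩
  refine ρ.induction_on_irreducible (P := fun w => capelli (ρ ∘ u) (ρ ∘ x) (ρ ∘ v) w = 0)
    (map_zero _) (fun v w hv hw => by rw [map_add, hv, hw, add_zero]) ?_ w
  intro W hne hinv hmin w hw
  have hdim : finrank ℂ W ≤ k := hk W ⟨hne, fun g v hv => hinv g v hv,
    fun W' h1 h2 h3 => hmin W' h1 h2 fun g v hv => h3 g v hv⟩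
  let r : Γ → End ℂ W := fun g => (ρ g).restrict (hinv g)
  have := capelli_semiconj_end W.subtype.toAddMonoidHom (u := r ∘ u) (x := r ∘ x) (v := r ∘ v)
    (u' := ρ ∘ u) (x' := ρ ∘ x) (v' := ρ ∘ v) (fun _ _ => rfl) (fun _ _ => rfl) (fun _ _ => rfl)
    ⟨w, hw⟩
  rw [capelli_eq_zero_of_finrank_lt ℂ (by
    rw [Module.finrank_linearMap, ← sq]
    exact Nat.lt_succ_of_le (Nat.pow_le_pow_left hdim 2))] at this
  simpa using this.symm

lemma exists_invariant_submodule_mod_prime (Γ : Subgroup (Matrix.GeneralLinearGroup (Fin m) ℤ))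
    [Finite Γ] {k : ℕ} (hk : ∀ W : Submodule ℂ (Fin m → ℂ),
      IsIrredC (fun g : Γ => (g.1 : Matrix (Fin m) (Fin m) ℤ)) W → finrank ℂ W ≤ k)
    (p : ℕ) [Fact p.Prime] (hp : (p : ZMod (Nat.card Γ)) = 1) {v : Fin m → ZMod p} (hv : v ≠ 0) :
    ∃ M : Submodule (ZMod p) (Fin m → ZMod p), v ∉ M ∧
      (∀ g ∈ Γ, ∀ w ∈ M, intRep (ZMod p) m g w ∈ M) ∧
      Nat.card ((Fin m → ZMod p) ⧸ M) ≤ p ^ k := by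
  let ρ : Representation (ZMod p) Γ (Fin m → ZMod p) := (intRep (ZMod p) m).comp Γ.subtype
  have hcard : Nat.card Γ ∣ p - 1 := by
    have h1 : ((p - 1 : ℕ) : ZMod (Nat.card Γ)) = 0 := by
      rw [Nat.cast_sub (Fact.out : p.Prime).one_le, hp, Nat.cast_one, sub_self]
    exact (ZMod.natCast_eq_zero_iff _ _).1 h1
  have hp1 : 1 < p := (Fact.out : p.Prime).one_lt
  have : NeZero (Nat.card Γ : ZMod p) := ⟨fun h => by
    have h1 := (ZMod.natCast_eq_zero_iff _ _).1 h
    have h2 := Nat.le_of_dvd (by omega) (h1.trans hcard)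
    omega⟩
  obtain ⟨M, hvM, hinv, hmax⟩ := ρ.exists_maximal_notMem hv
  refine ⟨M, hvM, fun g hg => hinv ⟨g, hg⟩, ?_⟩
  let V := (Fin m → ZMod p) ⧸ M
  let r : Γ →* End (ZMod p) V :=
    { toFun := fun g => M.mapQ M (ρ g) (hinv g)
      map_one' := by ext; simp
      map_mul' := fun a b => by ext; simp }
  have hr : ∀ g w, r g (M.mkQ w) = M.mkQ (ρ g w) := fun g w => rfl
  have hVn : Nontrivial V := ⟨⟨M.mkQ v, 0, fun h => hvM ((Submodule.Quotient.mk_eq_zero M).1 h)⟩⟩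
  have hirr : ActsIrreducibly (MonoidHom.mrange r : Set (End (ZMod p) V)) := by
    intro W hW
    have hle : M ≤ W.comap M.mkQ := fun x hx => by
      simp [(Submodule.Quotient.mk_eq_zero M).2 hx]
    have hmap : (W.comap M.mkQ).map M.mkQ = W :=
      Submodule.map_comap_eq_of_surjective M.mkQ_surjective W
    rcases hmax (W.comap M.mkQ) hle fun g w hw => by
      rw [Submodule.mem_comap, ← hr]
      exact hW _ ⟨g, rfl⟩ _ hw with h | h
    · left
      rw [← hmap, h]
      simp
    · right
      rw [← hmap, h]
      simp
  have hpow : ∀ s ∈ MonoidHom.mrange r, s ^ p = s := by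
    rintro _ ⟨g, rfl⟩
    obtain ⟨c, hc⟩ := hcard
    have hp' : p = Nat.card Γ * c + 1 := by omega
    rw [← map_pow]
    congr 1
    rw [hp', pow_succ, pow_mul, pow_card_eq_one', one_pow, one_mul]
  have hspan := span_eq_top_of_pow_eq_self (MonoidHom.mrange r) hirr hpow
  have hdim : finrank (ZMod p) V ≤ k := by
    by_contra! hlt
    obtain ⟨u, x, v, hu, hx, hv, hne⟩ := exists_capelli_ne_zero (N := k ^ 2 + 1) finrank_pos
      (Nat.pow_lt_pow_left hlt two_ne_zero) hspan
    choose u' hu' using hu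
    choose x' hx' using hx
    choose v' hv' using hv
    have hz := capelli_eq_zero_of_irred_le Γ hk u' x' v'
    have hz' := map_capelli (intEnd (ZMod p) m) (fun i => (u' i).1.1) (fun i => (x' i).1.1) (fun i => (v' i).1.1)
    rw [hz, map_zero] at hz'
    apply hne
    refine LinearMap.ext fun y => ?_
    obtain ⟨w, rfl⟩ := M.mkQ_surjective y
    have := capelli_semiconj_end M.mkQ.toAddMonoidHom (u := ρ ∘ u') (x := ρ ∘ x') (v := ρ ∘ v')
      (u' := u) (x' := x) (v' := v) (fun i a => by rw [← hu' i]; rfl)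
      (fun i a => by rw [← hx' i]; rfl) (fun i a => by rw [← hv' i]; rfl) w
    have h0 : capelli (ρ ∘ u') (ρ ∘ x') (ρ ∘ v') = 0 := hz'.symm
    rw [h0] at this
    simpa using this.symm
  rw [Module.natCard_eq_pow_finrank (K := ZMod p), Nat.card_zmod]
  exact Nat.pow_le_pow_right hp1.le hdim

end Reduction

section Upper

/-- Coordinates on a normal subgroup `K ≅ ℤ^m` in which conjugation acts through the matrices
`A g`. Values outside `K` are irrelevant. -/
structure LatticeChart {G : Type*} [Group G] (K : Subgroup G) (m : ℕ)
    (A : G →* Matrix.GeneralLinearGroup (Fin m) ℤ) where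
  /-- the coordinates -/
  coord : G → Fin m → ℤ
  coord_mul : ∀ x ∈ K, ∀ y ∈ K, coord (x * y) = coord x + coord y
  eq_one : ∀ x ∈ K, coord x = 0 → x = 1
  exists_coord : ∀ v, ∃ x ∈ K, coord x = v
  coord_conj : ∀ g, ∀ x ∈ K, coord (g * x * g⁻¹) = (A g).1.mulVec (coord x)

variable {G : Type*} [Group G] {K : Subgroup G} {m : ℕ}
  {A : G →* Matrix.GeneralLinearGroup (Fin m) ℤ}

namespace LatticeChart

lemma coord_one (ψ : LatticeChart K m A) : ψ.coord 1 = 0 := by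
  have := ψ.coord_mul 1 K.one_mem 1 K.one_mem
  simpa using this

lemma coord_inv (ψ : LatticeChart K m A) {x : G} (hx : x ∈ K) : ψ.coord x⁻¹ = -ψ.coord x := by
  have := ψ.coord_mul x hx x⁻¹ (K.inv_mem hx)
  rw [mul_inv_cancel, coord_one] at this
  exact (neg_eq_of_add_eq_zero_right this.symm).symm

lemma coord_injOn (ψ : LatticeChart K m A) {x y : G} (hx : x ∈ K) (hy : y ∈ K) (h : ψ.coord x = ψ.coord y) : x = y := by
  have := ψ.eq_one (x * y⁻¹) (K.mul_mem hx (K.inv_mem hy)) (by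
    rw [ψ.coord_mul _ hx _ (K.inv_mem hy), ψ.coord_inv hy, h, add_neg_cancel])
  exact mul_inv_eq_one.1 this

lemma apply_eq_one (ψ : LatticeChart K m A) {x : G} (hx : x ∈ K) : A x = 1 := by
  refine Units.ext (Matrix.ext_of_mulVec_single fun i => ?_)
  obtain ⟨y, hy, hyv⟩ := ψ.exists_coord (Pi.single i 1)
  rw [← hyv, ← ψ.coord_conj x y hy, ψ.coord_mul _ (K.mul_mem hx hy) _ (K.inv_mem hx),
    ψ.coord_mul _ hx _ hy, ψ.coord_inv hx]
  simp

lemma finite_range (ψ : LatticeChart K m A) (hK : K.FiniteIndex) : Finite A.range := by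
  have : K ≤ A.ker := fun x hx => ψ.apply_eq_one hx
  have := Subgroup.finiteIndex_of_le this
  exact Finite.of_equiv _ (QuotientGroup.quotientKerEquivRange A).toEquiv

/-- The subgroup of `K` cut out by an additive map on coordinates. -/
def kerSubgroup (ψ : LatticeChart K m A) {Q : Type*} [AddCommGroup Q] (f : (Fin m → ℤ) →+ Q) : Subgroup G where
  carrier := {x | x ∈ K ∧ f (ψ.coord x) = 0}
  mul_mem' := fun {x y} hx hy => ⟨K.mul_mem hx.1 hy.1, by
    rw [ψ.coord_mul _ hx.1 _ hy.1, map_add, hx.2, hy.2, add_zero]⟩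
  one_mem' := ⟨K.one_mem, by rw [ψ.coord_one, map_zero]⟩
  inv_mem' := fun {x} hx => ⟨K.inv_mem hx.1, by rw [ψ.coord_inv hx.1, map_neg, hx.2, neg_zero]⟩

lemma mem_kerSubgroup (ψ : LatticeChart K m A) {Q : Type*} [AddCommGroup Q] {f : (Fin m → ℤ) →+ Q} {x : G} :
    x ∈ ψ.kerSubgroup f ↔ x ∈ K ∧ f (ψ.coord x) = 0 := Iff.rfl

lemma normal_kerSubgroup (ψ : LatticeChart K m A) (hK : K.Normal) {Q : Type*} [AddCommGroup Q] (f : (Fin m → ℤ) →+ Q)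
    (hf : ∀ g v, f v = 0 → f ((A g).1.mulVec v) = 0) : (ψ.kerSubgroup f).Normal :=
  ⟨fun x hx g => ⟨hK.conj_mem x hx.1 g, by rw [ψ.coord_conj g x hx.1]; exact hf g _ hx.2⟩⟩

lemma index_kerSubgroup (ψ : LatticeChart K m A) (hK : K.FiniteIndex) {Q : Type*} [AddCommGroup Q] [Finite Q]
    (f : (Fin m → ℤ) →+ Q) :
    (ψ.kerSubgroup f).index ≠ 0 ∧ (ψ.kerSubgroup f).index ≤ Nat.card Q * K.index := by
  let φ : K →* Multiplicative Q :=
    { toFun := fun x => Multiplicative.ofAdd (f (ψ.coord x))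
      map_one' := by simp [coord_one]
      map_mul' := fun x y => by simp [ψ.coord_mul x.1 x.2 y.1 y.2] }
  have hle : ψ.kerSubgroup f ≤ K := fun x hx => hx.1
  have hker : (ψ.kerSubgroup f).subgroupOf K = φ.ker := by
    ext x
    simp only [Subgroup.mem_subgroupOf, mem_kerSubgroup, MonoidHom.mem_ker]
    exact ⟨fun h => h.2, fun h => ⟨x.2, h⟩⟩
  have hfin : Finite (Multiplicative Q) := ‹Finite Q›
  rw [← Subgroup.relIndex_mul_index hle, Subgroup.relIndex, hker, Subgroup.index_ker]
  refine ⟨mul_ne_zero Nat.card_pos.ne' hK.index_ne_zero, Nat.mul_le_mul_right _ ?_⟩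
  exact Nat.card_le_card_of_injective (β := Multiplicative Q) _ Subtype.val_injective

lemma exists_bound_coord (ψ : LatticeChart K m A) (hKn : K.Normal) (hK : K.FiniteIndex) (S : Finset G) :
    ∃ C : ℝ, 0 < C ∧ ∀ r : ℝ, 1 ≤ r → ∀ g ∈ wordBall S r, g ∈ K →
      ∀ i, |(ψ.coord g i : ℝ)| ≤ C * r := by
  classical
  let t : G ⧸ K → G := Quotient.out
  have ht : ∀ q, ((t q : G) : G ⧸ K) = q := fun q => Quotient.out_eq' q
  let c : G → (Fin m → ℤ) := fun g => ψ.coord (g * (t (g : G ⧸ K))⁻¹)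
  have hc : ∀ g : G, g * (t (g : G ⧸ K))⁻¹ ∈ K := fun g => by
    rw [← QuotientGroup.eq_one_iff, QuotientGroup.mk_mul, QuotientGroup.mk_inv, ht, mul_inv_cancel]
  let δ : G ⧸ K → G → G := fun q s => t q * s * (t (q * (s : G ⧸ K)))⁻¹
  have hδ : ∀ q s, δ q s ∈ K := fun q s => by
    rw [← QuotientGroup.eq_one_iff]
    simp only [δ, QuotientGroup.mk_mul, QuotientGroup.mk_inv, ht, mul_inv_cancel]
  have hstep : ∀ g s : G, c (g * s) = c g + ψ.coord (δ (g : G ⧸ K) s) := fun g s => by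
    rw [← ψ.coord_mul _ (hc g) _ (hδ _ _)]
    simp only [c, δ, QuotientGroup.mk_mul]
    congr 1
    group
  have hfinQ : Finite (G ⧸ K) := inferInstance
  let _ := Fintype.ofFinite (G ⧸ K)
  let S' : Finset G := S ∪ S.image (·⁻¹)
  let B : ℝ := ∑ q : G ⧸ K, ∑ s ∈ S', ‖fun i => (ψ.coord (δ q s) i : ℝ)‖
  have hB : ∀ q, ∀ s ∈ S', ∀ i, |(ψ.coord (δ q s) i : ℝ)| ≤ B := by
    intro q s hs i
    refine (norm_le_pi_norm (fun i => (ψ.coord (δ q s) i : ℝ)) i).trans ?_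
    refine le_trans ?_ (Finset.single_le_sum (f := fun q => ∑ s ∈ S',
      ‖fun i => (ψ.coord (δ q s) i : ℝ)‖) (fun q _ => Finset.sum_nonneg fun s _ => norm_nonneg _)
      (Finset.mem_univ q))
    exact Finset.single_le_sum (f := fun s => ‖fun i => (ψ.coord (δ q s) i : ℝ)‖)
      (fun s _ => norm_nonneg _) hs
  have hB0 : 0 ≤ B := Finset.sum_nonneg fun q _ => Finset.sum_nonneg fun s _ => norm_nonneg _
  let E : ℝ := ‖fun i => (c 1 i : ℝ)‖
  have hE : ∀ i, |(c 1 i : ℝ)| ≤ E := fun i => norm_le_pi_norm (fun i => (c 1 i : ℝ)) i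
  have hE0 : 0 ≤ E := norm_nonneg _
  have hword : ∀ l : List G, (∀ x ∈ l, x ∈ S ∨ x⁻¹ ∈ S) → ∀ i,
      |(c l.prod i : ℝ)| ≤ E + B * l.length := by
    intro l
    induction l using List.reverseRecOn with
    | nil => intro _ i; simpa using hE i
    | append_singleton l s ih =>
      intro hl i
      have hs : s ∈ S' := by
        have := hl s (by simp)
        simp only [S', Finset.mem_union, Finset.mem_image]
        exact this.imp id fun h => ⟨s⁻¹, h, inv_inv s⟩
      have h1 := ih (fun x hx => hl x (by simp [hx])) i
      rw [List.prod_append, List.prod_singleton, hstep]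
      have h2 := hB (l.prod : G ⧸ K) s hs i
      have h3 := abs_add_le (c l.prod i : ℝ) (ψ.coord (δ (l.prod : G ⧸ K) s) i : ℝ)
      simp only [Pi.add_apply, Int.cast_add, List.length_append, List.length_singleton,
        Nat.cast_add, Nat.cast_one]
      linarith
  refine ⟨2 * E + B + 1, by linarith, ?_⟩
  rintro r hr g ⟨l, hl, hlen, rfl⟩ hg i
  have hq : ((l.prod : G) : G ⧸ K) = ((1 : G) : G ⧸ K) := by
    rw [QuotientGroup.mk_one, QuotientGroup.eq_one_iff]; exact hg
  have hcg : c l.prod = ψ.coord l.prod + c 1 := by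
    have := hc 1
    simp only [c, hq]
    rw [← ψ.coord_mul _ hg _ this, one_mul]
  have h1 := hword l hl i
  have h2 : (ψ.coord l.prod i : ℝ) = c l.prod i - c 1 i := by
    rw [hcg]; simp
  have h3 := abs_sub (c l.prod i : ℝ) (c 1 i : ℝ)
  have h4 := hE i
  rw [h2]
  nlinarith [mul_le_mul_of_nonneg_left hlen hB0]

open Real in
lemma exists_normal_index_le (ψ : LatticeChart K m A) (hKn : K.Normal) (hK : K.FiniteIndex) {k : ℕ}
    (hk : ∀ W : Submodule ℂ (Fin m → ℂ),
      IsIrredC (fun g : A.range => (g.1 : Matrix (Fin m) (Fin m) ℤ)) W → Module.finrank ℂ W ≤ k)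
    (S : Finset G) :
    ∃ C : ℝ, 0 < C ∧ ∀ r : ℝ, 1 ≤ r → 1 ≤ C * log (C * r) ^ k ∧ ∀ g ∈ wordBall S r, g ≠ 1 →
      ∃ N ∈ nu G, g ∉ N ∧ (N.index : ℝ) ≤ C * log (C * r) ^ k := by
  have := ψ.finite_range hK
  have : NeZero (Nat.card A.range) := ⟨Nat.card_pos.ne'⟩
  obtain ⟨C₁, hC₁, hcoord⟩ := ψ.exists_bound_coord hKn hK S
  obtain ⟨C₂, hC₂, hprime⟩ := exists_prime_modEq_one_not_dvd (Nat.card A.range)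
  have hKi : (0 : ℝ) ≤ K.index := Nat.cast_nonneg _
  have hKC : 0 ≤ K.index * C₂ ^ k := by positivity
  refine ⟨C₁ + 3 + K.index + K.index * C₂ ^ k, by positivity, fun r hr => ?_⟩
  set C := C₁ + 3 + K.index + K.index * C₂ ^ k with hC
  have hlog1 : 1 ≤ log (C * r) := by
    rw [le_log_iff_exp_le (by positivity)]
    nlinarith [exp_one_lt_d9, mul_nonneg (show 0 ≤ C by positivity) (sub_nonneg.2 hr)]
  have hlogk : 1 ≤ log (C * r) ^ k := one_le_pow₀ hlog1
  refine ⟨by nlinarith, fun g hg hg1 => ?_⟩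
  by_cases hgK : g ∈ K
  swap
  · exact ⟨K, ⟨hKn, hK⟩, hgK, by nlinarith⟩
  obtain ⟨i, hi⟩ : ∃ i, ψ.coord g i ≠ 0 := by
    by_contra! h
    exact hg1 (ψ.eq_one g hgK (funext h))
  obtain ⟨p, hp, hpmod, hpdvd, hple⟩ := hprime (ψ.coord g i) (C * r) hi (by nlinarith)
    ((hcoord r hr g hg hgK i).trans (by gcongr; linarith))
  have : Fact p.Prime := ⟨hp⟩
  let red : (Fin m → ℤ) →+ (Fin m → ZMod p) :=
    (Int.castAddHom (ZMod p)).compLeft (Fin m)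
  obtain ⟨M, hvM, hinv, hcard⟩ := exists_invariant_submodule_mod_prime A.range hk p hpmod
    (v := red (ψ.coord g)) (fun h => hpdvd ((ZMod.intCast_zmod_eq_zero_iff_dvd _ p).1 (congrFun h i)))
  let f : (Fin m → ℤ) →+ ((Fin m → ZMod p) ⧸ M) := M.mkQ.toAddMonoidHom.comp red
  have hf : ∀ v, f v = 0 ↔ red v ∈ M := fun v => Submodule.Quotient.mk_eq_zero M
  have hidx := ψ.index_kerSubgroup hK f
  refine ⟨ψ.kerSubgroup f, ⟨ψ.normal_kerSubgroup hKn f fun a v hv => ?_, ⟨hidx.1⟩⟩, ?_, ?_⟩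
  · rw [hf] at hv ⊢
    have := hinv (A a) ⟨a, rfl⟩ _ hv
    rw [intRep_apply] at this
    exact (show red ((A a).1.mulVec v) = _ from map_mulVec_intCast (ZMod p) (A a).1 v) ▸ this
  · intro h
    exact hvM ((hf _).1 h.2)
  · have h1 : ((ψ.kerSubgroup f).index : ℝ) ≤ (p : ℝ) ^ k * K.index := by
      have := hidx.2.trans (Nat.mul_le_mul_right _ hcard)
      exact_mod_cast this
    have h2 : (p : ℝ) ^ k ≤ C₂ ^ k * log (C * r) ^ k := by
      rw [← mul_pow]
      gcongr
    calc ((ψ.kerSubgroup f).index : ℝ) ≤ (p : ℝ) ^ k * K.index := h1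
      _ ≤ (C₂ ^ k * log (C * r) ^ k) * K.index := by gcongr
      _ = (K.index * C₂ ^ k) * log (C * r) ^ k := by ring
      _ ≤ C * log (C * r) ^ k := by gcongr; linarith

end LatticeChart

lemma divFn_toNat_le {N : Subgroup G} (hN : N ∈ nu G) {g : G} (hg : g ∉ N) :
    (divFn (nu G) g).toNat ≤ N.index :=
  ENat.toNat_le_of_le_natCast (sInf_le ⟨N, hN, hg, rfl⟩)

lemma exists_index_eq_divFn {N : Subgroup G} (hN : N ∈ nu G) {g : G} (hg : g ∉ N) :
    ∃ N' ∈ nu G, g ∉ N' ∧ (divFn (nu G) g).toNat = N'.index := by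
  obtain ⟨N', hN', hg', h⟩ := csInf_mem (s := {n : ℕ∞ | ∃ N ∈ nu G, g ∉ N ∧ n = (N.index : ℕ∞)})
    ⟨_, N, hN, hg, rfl⟩
  exact ⟨N', hN', hg', by rw [divFn, h, ENat.toNat_natCast]⟩

lemma RFgrowth_le {S : Finset G} {r B : ℝ} (h1 : 1 ≤ B)
    (h : ∀ g ∈ wordBall S r, g ≠ 1 → ∃ N ∈ nu G, g ∉ N ∧ (N.index : ℝ) ≤ B) :
    RFgrowth (nu G) S r ≤ B := by
  refine csSup_le ⟨1, Set.mem_insert _ _⟩ ?_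
  rintro _ (rfl | ⟨g, ⟨hg, hg1⟩, rfl⟩)
  · exact h1
  · obtain ⟨N, hN, hgN, hle⟩ := h g hg hg1
    exact le_trans (Nat.cast_le.2 (divFn_toNat_le hN hgN)) hle

/-- A lower bound for `RFgrowth` from a single element, given an a priori upper bound. -/
lemma le_RFgrowth {S : Finset G} {r B b : ℝ}
    (h : ∀ g ∈ wordBall S r, g ≠ 1 → ∃ N ∈ nu G, g ∉ N ∧ (N.index : ℝ) ≤ B) {g : G}
    (hg : g ∈ wordBall S r) (hg1 : g ≠ 1) (hb : ∀ N ∈ nu G, g ∉ N → b ≤ N.index) :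
    b ≤ RFgrowth (nu G) S r := by
  obtain ⟨N, hN, hgN, -⟩ := h g hg hg1
  obtain ⟨N', hN', hgN', he⟩ := exists_index_eq_divFn hN hgN
  refine (hb N' hN' hgN').trans ?_
  rw [← he]
  refine le_csSup ⟨max 1 B, ?_⟩ (Or.inr ⟨g, ⟨hg, hg1⟩, rfl⟩)
  rintro _ (rfl | ⟨g, ⟨hg, hg1⟩, rfl⟩)
  · exact le_max_left _ _
  · obtain ⟨N, hN, hgN, hle⟩ := h g hg hg1
    exact le_trans (Nat.cast_le.2 (divFn_toNat_le hN hgN)) (hle.trans (le_max_right _ _))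

lemma one_le_RFgrowth {S : Finset G} {r B : ℝ}
    (h : ∀ g ∈ wordBall S r, g ≠ 1 → ∃ N ∈ nu G, g ∉ N ∧ (N.index : ℝ) ≤ B) :
    1 ≤ RFgrowth (nu G) S r := by
  refine le_csSup ⟨max 1 B, ?_⟩ (Or.inl rfl)
  rintro _ (rfl | ⟨g, ⟨hg, hg1⟩, rfl⟩)
  · exact le_max_left _ _
  · obtain ⟨N, hN, hgN, hle⟩ := h g hg hg1
    exact le_trans (Nat.cast_le.2 (divFn_toNat_le hN hgN)) (hle.trans (le_max_right _ _))

end Upper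

section FiniteAbelian
open Module

lemma capelli_eq_zero_of_surjective {R : Type*} [AddCommGroup R] {d N : ℕ}
    (f : (Fin d → ℤ) →ₗ[ℤ] R) (hf : Function.Surjective f) (hd : d ^ 2 < N)
    (u x v : Fin N → End ℤ R) : capelli u x v = 0 := by
  have hlift : ∀ φ : End ℤ R, ∃ φ' : End ℤ (Fin d → ℤ), ∀ a, f (φ' a) = φ (f a) := fun φ => by
    obtain ⟨φ', h⟩ := Module.projective_lifting_property f (φ.comp f) hf
    exact ⟨φ', fun a => congrArg (fun g : (Fin d → ℤ) →ₗ[ℤ] R => g a) h⟩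
  choose l hl using hlift
  refine LinearMap.ext fun y => ?_
  obtain ⟨a, rfl⟩ := hf y
  have := capelli_semiconj_end f.toAddMonoidHom (u := l ∘ u) (x := l ∘ x) (v := l ∘ v)
    (u' := u) (x' := x) (v' := v) (fun i a => hl _ a) (fun i a => hl _ a) (fun i a => hl _ a) a
  rw [capelli_eq_zero_of_finrank_lt ℤ (by
    rw [Module.finrank_linearMap, Module.finrank_fin_fun, ← sq]; exact hd)] at this
  simpa using this.symm

/-- Lifts of a basis of `R / pR` generate a group `R` of exponent `p ^ e`. -/
lemma exists_surjective_of_mod_prime {R V : Type*} [AddCommGroup R] [AddCommGroup V] {p e : ℕ}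
    [Fact p.Prime] [Finite V] (hV : ∀ y : V, p • y = 0) (π : R →+ V)
    (hπ : Function.Surjective π) (hker : ∀ x, π x = 0 → ∃ y, p • y = x)
    (he : ∀ x : R, p ^ e • x = 0) :
    ∃ d, Nat.card V = p ^ d ∧ ∃ f : (Fin d → ℤ) →ₗ[ℤ] R, Function.Surjective f := by
  obtain ⟨_⟩ : Nonempty (Module (ZMod p) V) := ⟨AddCommGroup.zmodModule hV⟩
  refine ⟨finrank (ZMod p) V, by rw [Module.natCard_eq_pow_finrank (K := ZMod p), Nat.card_zmod], ?_⟩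
  have hfin : Module.Finite (ZMod p) V := Module.Finite.of_finite
  let b := finBasis (ZMod p) V
  choose r hr using fun i => hπ (b i)
  let f := Fintype.linearCombination ℤ r
  refine ⟨f, ?_⟩
  have hstep : ∀ x : R, ∃ a y, x = f a + p • y := fun x => by
    have h1 := b.sum_repr (π x)
    let a : Fin (finrank (ZMod p) V) → ℤ := fun i => ((b.repr (π x) i).val : ℤ)
    have h2 : π (f a) = π x := by
      rw [← h1]
      simp only [f, Fintype.linearCombination_apply, map_sum, a]
      refine Finset.sum_congr rfl fun i _ => ?_
      rw [natCast_zsmul, map_nsmul, hr, ← Nat.cast_smul_eq_nsmul (ZMod p), ZMod.natCast_zmod_val]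
    obtain ⟨y, hy⟩ := hker (x - f a) (by rw [map_sub, h2, sub_self])
    exact ⟨a, y, by rw [hy]; abel⟩
  have hiter : ∀ j : ℕ, ∀ x : R, ∃ a y, x = f a + p ^ j • y := fun j => by
    induction j with
    | zero => exact fun x => ⟨0, x, by simp⟩
    | succ j ih =>
      intro x
      obtain ⟨a, y, rfl⟩ := ih x
      obtain ⟨a', y', rfl⟩ := hstep y
      refine ⟨a + p ^ j • a', y', ?_⟩
      rw [map_add, map_nsmul, smul_add, smul_smul, ← pow_succ, add_assoc]
  intro x
  obtain ⟨a, y, h⟩ := hiter e x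
  exact ⟨a, by rw [h, he, add_zero]⟩

/-- A finite abelian `p`-group `R` with `|R / pR| < p ^ k` has fewer than `k` generators. -/
lemma exists_surjective_of_card_lt {R : Type*} [AddCommGroup R] [Finite R] {p k e : ℕ}
    [Fact p.Prime] (he : ∀ x : R, p ^ e • x = 0)
    (hcard : Nat.card R < p ^ k * Nat.card (nsmulAddMonoidHom p : R →+ R).range) :
    ∃ d < k, ∃ f : (Fin d → ℤ) →ₗ[ℤ] R, Function.Surjective f := by
  let P : AddSubgroup R := (nsmulAddMonoidHom p : R →+ R).range
  obtain ⟨d, hd, hf⟩ := exists_surjective_of_mod_prime (V := R ⧸ P) (fun y => by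
    obtain ⟨x, rfl⟩ := QuotientAddGroup.mk_surjective y
    exact (QuotientAddGroup.eq_zero_iff _).2 ⟨x, rfl⟩) (QuotientAddGroup.mk' P)
    (QuotientAddGroup.mk'_surjective P) (fun x hx => (QuotientAddGroup.eq_zero_iff _).1 hx) he
  refine ⟨d, ?_, hf⟩
  rw [AddSubgroup.card_eq_card_quotient_mul_card_addSubgroup P, hd] at hcard
  exact (Nat.pow_lt_pow_iff_right (Fact.out : p.Prime).one_lt).1
    (Nat.lt_of_mul_lt_mul_right hcard)

lemma pow_le_card_of_capelli {Q : Type*} [AddCommGroup Q] [Finite Q] {k : ℕ}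
    (u x v : Fin ((k - 1) ^ 2 + 1) → End ℤ Q) (w : Q) {p a : ℕ} (hp : p.Prime)
    (ha : p ^ a ∣ addOrderOf (capelli u x v w)) : (p ^ a) ^ k ≤ Nat.card Q := by
  have : Fact p.Prime := ⟨hp⟩
  obtain ⟨e, t, hpt, het⟩ := Nat.exists_eq_pow_mul_and_not_dvd (Nat.card_pos (α := Q)).ne' p hp.ne_one
  let R : ℕ → AddSubgroup Q := fun i => (nsmulAddMonoidHom (p ^ i * t) : Q →+ Q).range
  have hmem : ∀ i (φ : End ℤ Q), ∀ y ∈ (R i).toIntSubmodule, φ y ∈ (R i).toIntSubmodule := by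
    rintro i φ _ ⟨y, rfl⟩
    exact ⟨φ y, by simp⟩
  have hR : ∀ i < a, p ^ k * Nat.card (R (i + 1)) ≤ Nat.card (R i) := by
    intro i hi
    by_contra! hlt
    have hmap : ((nsmulAddMonoidHom p : R i →+ R i).range).map (R i).subtype = R (i + 1) := by
      ext y
      constructor
      · rintro ⟨_, ⟨⟨_, q, rfl⟩, rfl⟩, rfl⟩
        exact ⟨q, by simp [pow_succ', mul_assoc, mul_smul]⟩
      · rintro ⟨q, rfl⟩
        exact ⟨_, ⟨⟨_, q, rfl⟩, rfl⟩, by simp [pow_succ', mul_assoc, mul_smul]⟩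
    rw [← hmap, AddSubgroup.card_map_of_injective Subtype.val_injective] at hlt
    obtain ⟨d, hd, f, hf⟩ := exists_surjective_of_card_lt (e := e) (fun y => by
      obtain ⟨_, q, rfl⟩ := y
      apply Subtype.ext
      simp only [AddSubgroup.coe_nsmul, nsmulAddMonoidHom_apply, smul_smul]
      rw [show p ^ e * (p ^ i * t) = p ^ i * Nat.card Q by rw [het]; ring, mul_smul, card_nsmul_eq_zero',
        smul_zero]; rfl) hlt
    let res : End ℤ Q → End ℤ (R i) := fun φ => φ.restrict (p := (R i).toIntSubmodule) (q := (R i).toIntSubmodule) (hmem i φ)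
    have h0 := capelli_eq_zero_of_surjective f hf (N := (k - 1) ^ 2 + 1)
      (Nat.lt_succ_of_le (Nat.pow_le_pow_left (Nat.le_sub_one_of_lt hd) 2)) (res ∘ u) (res ∘ x) (res ∘ v)
    have h1 := capelli_semiconj_end (R i).subtype (u := res ∘ u) (x := res ∘ x) (v := res ∘ v)
      (u' := u) (x' := x) (v' := v) (fun _ _ => rfl) (fun _ _ => rfl) (fun _ _ => rfl)
      ⟨_, w, rfl⟩
    rw [h0] at h1
    have h2 : (p ^ i * t) • capelli u x v w = 0 := by
      rw [← map_nsmul]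
      exact h1.symm
    have h3 := ha.trans (addOrderOf_dvd_of_nsmul_eq_zero h2)
    have hcop : Nat.Coprime (p ^ a) t := Nat.Coprime.pow_left _ ((Nat.Prime.coprime_iff_not_dvd hp).2 hpt)
    have h5 := (Nat.pow_dvd_pow_iff_le_right hp.one_lt).1 (hcop.dvd_of_dvd_mul_right h3)
    omega
  have htel : ∀ j ≤ a, (p ^ k) ^ j * Nat.card (R j) ≤ Nat.card (R 0) := fun j => by
    induction j with
    | zero => simp
    | succ j ih =>
      intro hj
      refine le_trans ?_ (ih (by omega))
      rw [pow_succ, mul_assoc]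
      exact Nat.mul_le_mul_left _ (hR j (by omega))
  calc (p ^ a) ^ k = (p ^ k) ^ a * 1 := by rw [mul_one, ← pow_mul, ← pow_mul, mul_comm]
    _ ≤ (p ^ k) ^ a * Nat.card (R a) := Nat.mul_le_mul_left _ Nat.card_pos
    _ ≤ Nat.card (R 0) := htel a le_rfl
    _ ≤ Nat.card Q := Nat.card_le_card_of_injective _ Subtype.val_injective

end FiniteAbelian

section Lower
open Module

variable {m : ℕ}

/-- An irreducible complex constituent of dimension `k ≥ 1` makes a Capelli polynomial of degree
`(k - 1)² + 1` in the middle variables nonzero on `Γ`. -/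
lemma exists_capelli_ne_zero_of_irred (Γ : Subgroup (Matrix.GeneralLinearGroup (Fin m) ℤ))
    {W : Submodule ℂ (Fin m → ℂ)}
    (hW : IsIrredC (fun g : Γ => (g.1 : Matrix (Fin m) (Fin m) ℤ)) W) {k : ℕ} (hk : 1 ≤ k)
    (hWk : finrank ℂ W = k) :
    ∃ u x v : Fin ((k - 1) ^ 2 + 1) → Γ,
      capelli (fun i => (u i).1.1) (fun i => (x i).1.1) (fun i => (v i).1.1) ≠ 0 := by
  let r : Γ →* End ℂ W :=
    { toFun := fun g => (intRep ℂ m g.1).restrict (hW.2.1 g)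
      map_one' := by ext; simp
      map_mul' := fun a b => LinearMap.ext fun y => Subtype.ext (by simp; rfl) }
  have hWn : Nontrivial W := Submodule.nontrivial_iff_ne_bot.2 hW.1
  have hirr : ActsIrreducibly (MonoidHom.mrange r : Set (End ℂ W)) := fun U hU => by
    by_cases h0 : U = ⊥
    · exact Or.inl h0
    · right
      have h1 : U.map W.subtype = W := by
        refine hW.2.2 _ (Submodule.map_subtype_le _ _)
          (fun h => h0 ((Submodule.map_injective_of_injective W.subtype_injective)
            (h.trans (Submodule.map_bot _).symm))) fun g => ?_
        rintro _ ⟨y, hy, rfl⟩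
        exact ⟨r g y, hU _ ⟨g, rfl⟩ y hy, rfl⟩
      rw [← Submodule.map_injective_of_injective W.subtype_injective |>.eq_iff, h1,
        Submodule.map_top, Submodule.range_subtype]
  have hN : (k - 1) ^ 2 + 1 ≤ finrank ℂ W ^ 2 := by
    rw [hWk]
    obtain ⟨j, rfl⟩ := Nat.exists_eq_add_of_le hk
    rw [Nat.add_sub_cancel_left]
    nlinarith
  obtain ⟨u, x, v, hu, hx, hv, hne⟩ := exists_capelli_ne_zero (by omega) hN
    (span_eq_top_of_isAlgClosed _ hirr)
  choose u' hu' using hu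
  choose x' hx' using hx
  choose v' hv' using hv
  refine ⟨u', x', v', fun h0 => hne (LinearMap.ext fun a => W.subtype_injective ?_)⟩
  have h1 := map_capelli (intEnd ℂ m)
    (fun i => (u' i).1.1) (fun i => (x' i).1.1) (fun i => (v' i).1.1)
  rw [h0, map_zero] at h1
  have h2 := capelli_semiconj_end W.subtype.toAddMonoidHom (u := u) (x := x) (v := v)
    (u' := intEnd ℂ m ∘ fun i => (u' i).1.1) (x' := intEnd ℂ m ∘ fun i => (x' i).1.1)
    (v' := intEnd ℂ m ∘ fun i => (v' i).1.1) (fun i a => by rw [← hu' i]; rfl)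
    (fun i a => by rw [← hx' i]; rfl) (fun i a => by rw [← hv' i]; rfl) a
  rw [← h1] at h2
  exact h2

variable {G : Type*} [Group G] {K : Subgroup G} {A : G →* Matrix.GeneralLinearGroup (Fin m) ℤ}

namespace LatticeChart

lemma coord_pow (ψ : LatticeChart K m A) {x : G} (hx : x ∈ K) (n : ℕ) :
    ψ.coord (x ^ n) = n • ψ.coord x := by
  induction n with
  | zero => simp [coord_one]
  | succ n ih => rw [pow_succ, ψ.coord_mul _ (K.pow_mem hx n) _ hx, ih, succ_nsmul]

/-- The lattice of coordinates of `N ∩ K`. -/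
def lattice (ψ : LatticeChart K m A) (N : Subgroup G) : AddSubgroup (Fin m → ℤ) where
  carrier := {a | ∃ y ∈ N, y ∈ K ∧ ψ.coord y = a}
  add_mem' := by
    rintro _ _ ⟨y, hy, hyK, rfl⟩ ⟨z, hz, hzK, rfl⟩
    exact ⟨y * z, N.mul_mem hy hz, K.mul_mem hyK hzK, ψ.coord_mul y hyK z hzK⟩
  zero_mem' := ⟨1, N.one_mem, K.one_mem, ψ.coord_one⟩
  neg_mem' := by
    rintro _ ⟨y, hy, hyK, rfl⟩
    exact ⟨y⁻¹, N.inv_mem hy, K.inv_mem hyK, ψ.coord_inv hyK⟩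

lemma coord_mem_lattice (ψ : LatticeChart K m A) {N : Subgroup G} {x : G} (hx : x ∈ K) :
    ψ.coord x ∈ ψ.lattice N ↔ x ∈ N := by
  refine ⟨?_, fun h => ⟨x, h, hx, rfl⟩⟩
  rintro ⟨y, hy, hyK, h⟩
  rwa [← ψ.coord_injOn hyK hx h]

lemma exists_injective_quotient_lattice (ψ : LatticeChart K m A) (N : Subgroup G) :
    ∃ f : (Fin m → ℤ) ⧸ (ψ.lattice N).toIntSubmodule → G ⧸ N, Function.Injective f := by
  choose s hsK hs using ψ.exists_coord
  refine ⟨fun q => (s q.out : G ⧸ N), fun q q' h => ?_⟩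
  have h1 : (s q.out)⁻¹ * s q'.out ∈ N := QuotientGroup.eq.1 h
  rw [← ψ.coord_mem_lattice (K.mul_mem (K.inv_mem (hsK _)) (hsK _)),
    ψ.coord_mul _ (K.inv_mem (hsK _)) _ (hsK _), ψ.coord_inv (hsK _), hs, hs] at h1
  rw [← Submodule.Quotient.mk_out q, ← Submodule.Quotient.mk_out q']
  refine ((Submodule.Quotient.eq _).2 ?_).symm
  rwa [sub_eq_neg_add]

lemma mulVec_mem_lattice (ψ : LatticeChart K m A) (hK : K.Normal) {N : Subgroup G} (hN : N.Normal)
    (g : A.range) {a : Fin m → ℤ} (ha : a ∈ ψ.lattice N) : g.1.1.mulVec a ∈ ψ.lattice N := by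
  obtain ⟨y, hy, hyK, rfl⟩ := ha
  obtain ⟨_, g, rfl⟩ := g
  exact ⟨g * y * g⁻¹, hN.conj_mem y hy g, hK.conj_mem y hyK g, ψ.coord_conj g y hyK⟩

/-- If a power `h ^ L` of an element `h ∈ K` whose coordinates are a value of a Capelli polynomial
survives in `G / N`, where `L` is divisible by `1, …, n`, then `N` has index at least
`(n + 1) ^ k`. -/
lemma pow_le_index (ψ : LatticeChart K m A) (hK : K.Normal) {k n L : ℕ}
    (u x v : Fin ((k - 1) ^ 2 + 1) → A.range) (w : Fin m → ℤ) {h : G} (hh : h ∈ K)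
    (hw : ψ.coord h = (capelli (fun i => (u i).1.1) (fun i => (x i).1.1)
      (fun i => (v i).1.1)).mulVec w)
    (hL : ∀ j, 1 ≤ j → j ≤ n → j ∣ L) {N : Subgroup G} (hN : N ∈ nu G) (hLN : h ^ L ∉ N) :
    (n + 1) ^ k ≤ N.index := by
  obtain ⟨f, hf⟩ := ψ.exists_injective_quotient_lattice N
  have hNf : Finite (G ⧸ N) := @Subgroup.finite_quotient_of_finiteIndex _ _ N hN.2
  have hQ := Finite.of_injective f hf
  refine le_trans ?_ (Nat.card_le_card_of_injective f hf)
  let M := (ψ.lattice N).toIntSubmodule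
  let act : A.range → End ℤ ((Fin m → ℤ) ⧸ M) := fun g =>
    M.mapQ M (intEnd ℤ m g.1.1) fun a ha => ψ.mulVec_mem_lattice hK hN.1 g ha
  have h1 := map_capelli (intEnd ℤ m)
    (fun i => (u i).1.1) (fun i => (x i).1.1) (fun i => (v i).1.1)
  have h2 := capelli_semiconj_end M.mkQ.toAddMonoidHom
    (u := intEnd ℤ m ∘ fun i => (u i).1.1) (x := intEnd ℤ m ∘ fun i => (x i).1.1)
    (v := intEnd ℤ m ∘ fun i => (v i).1.1) (u' := act ∘ u) (x' := act ∘ x) (v' := act ∘ v)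
    (fun i a => rfl) (fun i a => rfl) (fun i a => rfl) w
  rw [← h1, intEnd_apply] at h2
  have h3 : M.mkQ (ψ.coord h) = capelli (act ∘ u) (act ∘ x) (act ∘ v) (M.mkQ w) := by
    rw [hw]
    exact h2
  have hord : ¬ addOrderOf (M.mkQ (ψ.coord h)) ∣ L := fun hd => hLN <| by
    rw [← ψ.coord_mem_lattice (K.pow_mem hh L), ψ.coord_pow hh]
    have := addOrderOf_dvd_iff_nsmul_eq_zero.1 hd
    rw [← map_nsmul] at this
    exact (Submodule.Quotient.mk_eq_zero M).1 this
  obtain ⟨p, a, hp, hpa, hpL⟩ : ∃ p a : ℕ, p.Prime ∧ p ^ a ∣ addOrderOf (M.mkQ (ψ.coord h)) ∧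
      ¬ p ^ a ∣ L := by
    by_contra! hcon
    exact hord ((Nat.dvd_iff_prime_pow_dvd_dvd _ _).2 fun p a hp h => hcon p a hp h)
  have hn : n + 1 ≤ p ^ a := by
    by_contra! hlt
    exact hpL (hL _ (Nat.one_le_pow _ _ hp.pos) (by omega))
  rw [h3] at hpa
  exact (Nat.pow_le_pow_left hn k).trans (pow_le_card_of_capelli _ _ _ _ hp hpa)

end LatticeChart

lemma pow_mem_wordBall {S : Finset G} {r : ℝ} {g : G} (hg : g ∈ wordBall S r) (n : ℕ) :
    g ^ n ∈ wordBall S (n * r) := by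
  obtain ⟨l, hl, hlr, rfl⟩ := hg
  refine ⟨(List.replicate n l).flatten, fun x hx => ?_, ?_, by simp⟩
  · obtain ⟨l', hl', hx⟩ := List.mem_flatten.1 hx
    rw [(List.mem_replicate.1 hl').2] at hx
    exact hl x hx
  · simp only [List.length_flatten, List.map_replicate, List.sum_replicate, smul_eq_mul,
      Nat.cast_mul]
    gcongr

lemma exists_mem_wordBall {S : Finset G} (hS : Subgroup.closure (S : Set G) = ⊤) (g : G) :
    ∃ n : ℕ, g ∈ wordBall S n := by
  have hg : g ∈ (Subgroup.closure (S : Set G)).toSubmonoid := by rw [hS]; exact Subgroup.mem_top g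
  rw [Subgroup.closure_toSubmonoid] at hg
  obtain ⟨l, hl, rfl⟩ := Submonoid.exists_list_of_mem_closure hg
  exact ⟨l.length, l, hl, le_rfl, rfl⟩

lemma wordBall_mono {S : Finset G} {r r' : ℝ} (h : r ≤ r') : wordBall S r ⊆ wordBall S r' :=
  fun _ ⟨l, hl, hlr, hg⟩ => ⟨l, hl, hlr.trans h, hg⟩

open Real in
lemma LatticeChart.growthLE_log_pow (ψ : LatticeChart K m A) (hK : K.Normal) {k : ℕ}
    {u x v : Fin ((k - 1) ^ 2 + 1) → A.range}
    (hne : capelli (fun i => (u i).1.1) (fun i => (x i).1.1) (fun i => (v i).1.1) ≠ 0)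
    {S : Finset G} (hS : Subgroup.closure (S : Set G) = ⊤)
    (hfin : ∀ r : ℝ, 1 ≤ r → ∃ B : ℝ, ∀ g ∈ wordBall S r, g ≠ 1 →
      ∃ N ∈ nu G, g ∉ N ∧ (N.index : ℝ) ≤ B) :
    GrowthLE (fun r => log r ^ k) (RFgrowth (nu G) S) := by
  obtain ⟨w, hw⟩ : ∃ w, (capelli (fun i => (u i).1.1) (fun i => (x i).1.1)
      (fun i => (v i).1.1)).mulVec w ≠ 0 := by
    by_contra! hcon
    exact hne (Matrix.ext_of_mulVec_single fun i => by rw [hcon, Matrix.zero_mulVec])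
  obtain ⟨h, hhK, hh⟩ := ψ.exists_coord ((capelli (fun i => (u i).1.1) (fun i => (x i).1.1)
      (fun i => (v i).1.1)).mulVec w)
  obtain ⟨l, hl⟩ := exists_mem_wordBall hS h
  set c := log 4 + 4 with hc
  have hc0 : 0 < c := by
    have := log_nonneg (show (1 : ℝ) ≤ 4 by norm_num)
    positivity
  have hl0 : (0 : ℝ) ≤ l := Nat.cast_nonneg l
  have hck : 0 < c ^ k := by positivity
  refine ⟨l + 1 + c ^ k, by positivity, fun r hr => ?_⟩
  have hr1 : 1 ≤ r := (le_max_left _ _).trans hr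
  set C := (l : ℝ) + 1 + c ^ k with hC
  have hC1 : 1 ≤ C := by linarith
  obtain ⟨B, hB⟩ := hfin (C * r) (one_le_mul_of_one_le_of_one_le hC1 hr1)
  set n := ⌊log r / c⌋₊ with hn
  have hlog : 0 ≤ log r := log_nonneg hr1
  have hLr : (Nat.lcmUpto n : ℝ) ≤ r := by
    rw [← log_le_log_iff (Nat.cast_pos.2 (Nat.lcmUpto_pos n)) (by linarith),
      ← Chebyshev.psi_eq_log_lcmUpto]
    refine (Chebyshev.psi_le_const_mul_self (Nat.cast_nonneg n)).trans ?_
    rw [mul_comm, ← le_div_iff₀ hc0]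
    exact Nat.floor_le (by positivity)
  have hmem : h ^ Nat.lcmUpto n ∈ wordBall S (C * r) := by
    refine wordBall_mono ?_ (pow_mem_wordBall hl _)
    rw [mul_comm]
    exact mul_le_mul (by linarith) hLr (Nat.cast_nonneg _) (by linarith)
  have hne1 : h ^ Nat.lcmUpto n ≠ 1 := fun h1 => by
    have := ψ.coord_pow hhK (Nat.lcmUpto n)
    rw [h1, ψ.coord_one, hh, eq_comm, smul_eq_zero] at this
    exact this.elim (Nat.lcmUpto_ne_zero n) hw
  have hRF : ((n + 1 : ℕ) : ℝ) ^ k ≤ RFgrowth (nu G) S (C * r) :=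
    le_RFgrowth hB hmem hne1 fun N hN hgN => by
      exact_mod_cast ψ.pow_le_index hK u x v w hhK hh
        (fun j h1 h2 => Finset.dvd_lcm (f := id) (Finset.mem_Icc.2 ⟨h1, h2⟩)) hN hgN
  have hle : log r ≤ c * (n + 1 : ℕ) := by
    rw [mul_comm, ← div_le_iff₀ hc0]
    exact_mod_cast (Nat.lt_floor_add_one _).le
  calc log r ^ k ≤ (c * (n + 1 : ℕ)) ^ k := by gcongr
    _ = c ^ k * ((n + 1 : ℕ) : ℝ) ^ k := mul_pow _ _ _
    _ ≤ C * RFgrowth (nu G) S (C * r) := by gcongr; linarith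

end Lower

section Assembly
open Matrix

variable {G : Type*} [Group G] {K : Subgroup G} {m : ℕ}

lemma conjMatrix_mul (hKn : K.Normal) (e : K ≃* Multiplicative (Fin m → ℤ))
    (A : G → GeneralLinearGroup (Fin m) ℤ)
    (hconj : ∀ (g x : G) (hx : x ∈ K),
      Multiplicative.toAdd (e ⟨g * x * g⁻¹, hKn.conj_mem x hx g⟩) =
        (A g).1.mulVec (Multiplicative.toAdd (e ⟨x, hx⟩))) (g h : G) : A (g * h) = A g * A h := by
  refine Units.ext (Matrix.ext_of_mulVec_single fun i => ?_)
  obtain ⟨⟨x, hx⟩, hxi⟩ := e.surjective (Multiplicative.ofAdd (Pi.single i 1))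
  have hxi' : Multiplicative.toAdd (e ⟨x, hx⟩) = Pi.single i 1 := by rw [hxi, toAdd_ofAdd]
  rw [← hxi', Units.val_mul, ← Matrix.mulVec_mulVec, ← hconj h x hx,
    ← hconj g _ (hKn.conj_mem x hx h), ← hconj (g * h) x hx]
  congr 3
  group

open Classical in
/-- The chart given by an isomorphism `K ≅ ℤ^m`. -/
noncomputable def latticeChartOfEquiv (hKn : K.Normal) (e : K ≃* Multiplicative (Fin m → ℤ))
    (A : G →* GeneralLinearGroup (Fin m) ℤ)
    (hconj : ∀ (g x : G) (hx : x ∈ K),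
      Multiplicative.toAdd (e ⟨g * x * g⁻¹, hKn.conj_mem x hx g⟩) =
        (A g).1.mulVec (Multiplicative.toAdd (e ⟨x, hx⟩))) : LatticeChart K m A where
  coord g := if hg : g ∈ K then Multiplicative.toAdd (e ⟨g, hg⟩) else 0
  coord_mul x hx y hy := by
    rw [dif_pos hx, dif_pos hy, dif_pos (K.mul_mem hx hy), ← toAdd_mul, ← map_mul]
    rfl
  eq_one x hx h := by
    rw [dif_pos hx, toAdd_eq_zero, map_eq_one_iff e e.injective] at h
    exact congrArg Subtype.val h
  exists_coord v := by
    obtain ⟨⟨x, hx⟩, hxv⟩ := e.surjective (Multiplicative.ofAdd v)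
    exact ⟨x, hx, by rw [dif_pos hx, hxv, toAdd_ofAdd]⟩
  coord_conj g x hx := by
    rw [dif_pos hx, dif_pos (hKn.conj_mem x hx g)]
    exact hconj g x hx

lemma isIrredC_comp_surjective {ι ι' : Type*} {f : ι → ι'} (hf : Function.Surjective f)
    (ρ : ι' → Matrix (Fin m) (Fin m) ℤ) (W : Submodule ℂ (Fin m → ℂ)) :
    IsIrredC (fun i => ρ (f i)) W ↔ IsIrredC ρ W := by
  simp only [IsIrredC, InvariantC, hf.forall]

end Assembly

/-- let `G` be a finitely generated virtually abelian group with a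
torsion-free abelian normal subgroup `K ≅ ℤ^m` of finite index, and let
`φ : G/K → GL(m,ℤ)` be the integral representation induced by conjugation (encoded
here by the matrices `A g`, `g ∈ G`, describing conjugation on `K ≅ ℤ^m`). If `k`
is the maximal dimension of an irreducible subrepresentation of `φ` over `ℂ`, then
for every finite generating set of `G` we have `RF_{G,ν(G),B_G} ≈ log^k`. -/
theorem stmt_0 {G : Type*} [Group G]
    (K : Subgroup G) (hKn : K.Normal) (hKfi : K.FiniteIndex)
    (m : ℕ) (e : K ≃* Multiplicative (Fin m → ℤ))
    (A : G → Matrix.GeneralLinearGroup (Fin m) ℤ)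
    (hconj : ∀ (g x : G) (hx : x ∈ K),
      Multiplicative.toAdd (e ⟨g * x * g⁻¹, hKn.conj_mem x hx g⟩) =
        ((A g : Matrix (Fin m) (Fin m) ℤ)).mulVec (Multiplicative.toAdd (e ⟨x, hx⟩)))
    (k : ℕ)
    (hk_le : ∀ W : Submodule ℂ (Fin m → ℂ),
      IsIrredC (fun g : G => (A g : Matrix (Fin m) (Fin m) ℤ)) W →
        Module.finrank ℂ W ≤ k)
    (hk_max : (∃ W : Submodule ℂ (Fin m → ℂ),
        IsIrredC (fun g : G => (A g : Matrix (Fin m) (Fin m) ℤ)) W ∧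
          Module.finrank ℂ W = k) ∨
      (k = 0 ∧ ∀ W : Submodule ℂ (Fin m → ℂ),
        ¬ IsIrredC (fun g : G => (A g : Matrix (Fin m) (Fin m) ℤ)) W)) :
    ∀ S : Finset G, Subgroup.closure (S : Set G) = ⊤ →
      GrowthEquiv (RFgrowth (nu G) S) (fun r => (Real.log r) ^ k) := by
  intro S hS
  let A' : G →* Matrix.GeneralLinearGroup (Fin m) ℤ :=
    MonoidHom.mk' A (conjMatrix_mul hKn e A hconj)
  have ψ : LatticeChart K m A' := latticeChartOfEquiv hKn e A' hconj
  have hirr := isIrredC_comp_surjective A'.rangeRestrict_surjective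
    (fun g : A'.range => (g.1 : Matrix (Fin m) (Fin m) ℤ))
  obtain ⟨C, hC, hup⟩ := ψ.exists_normal_index_le hKn hKfi
    (fun W hW => hk_le W ((hirr W).2 hW)) S
  have hfin : ∀ r : ℝ, 1 ≤ r → ∃ B : ℝ, ∀ g ∈ wordBall S r, g ≠ 1 →
      ∃ N ∈ nu G, g ∉ N ∧ (N.index : ℝ) ≤ B := fun r hr => ⟨_, (hup r hr).2⟩
  refine ⟨⟨C, hC, fun r hr => ?_⟩, ?_⟩
  · obtain ⟨h1, h2⟩ := hup r ((le_max_left _ _).trans hr)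
    exact RFgrowth_le h1 h2
  · rcases Nat.eq_zero_or_pos k with rfl | hk
    · refine ⟨1, one_pos, fun r hr => ?_⟩
      simp only [pow_zero, one_mul]
      obtain ⟨B, hB⟩ := hfin r ((le_max_left _ _).trans hr)
      exact one_le_RFgrowth hB
    · obtain ⟨W, hW, hWk⟩ := hk_max.resolve_right fun h => hk.ne' h.1
      obtain ⟨u, x, v, hne⟩ := exists_capelli_ne_zero_of_irred A'.range ((hirr W).1 hW) hk hWk
      exact ψ.growthLE_log_pow hKn hne hS hfin
end

section
/- Let S be a set of prime numbers such that there exist constants C_1, C_2, M > 0 with C_1·x ≤ log(∏_{p∈S, p≤x} p) ≤ C_2·x for all x ≥ M. Then there exist constants D_1, D_2 > 0 such that for every positive integer m there exists a prime p ∈ S with p ≤ D_1·log(m) + D_2 and p ∤ m. -/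
open Finset in
/-- if `S` is a set of primes with `log(∏_{p ∈ S, p ≤ x} p) ≍ x`, then
there are constants `D₁, D₂ > 0` such that every positive integer `m` admits a prime
`p ∈ S` with `p ≤ D₁·log m + D₂` and `p ∤ m`. -/
theorem stmt_8 (S : Set ℕ) [DecidablePred (· ∈ S)] (hprime : ∀ p ∈ S, p.Prime)
    (C₁ C₂ M : ℝ) (hC₁ : 0 < C₁) (hC₂ : 0 < C₂) (hM : 0 < M)
    (hlow : ∀ x : ℝ, M ≤ x →
      C₁ * x ≤ Real.log (∏ p ∈ (Finset.range (⌊x⌋₊ + 1)).filter (· ∈ S), (p : ℝ)))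
    (hhigh : ∀ x : ℝ, M ≤ x →
      Real.log (∏ p ∈ (Finset.range (⌊x⌋₊ + 1)).filter (· ∈ S), (p : ℝ)) ≤ C₂ * x) :
    ∃ D₁ D₂ : ℝ, 0 < D₁ ∧ 0 < D₂ ∧ ∀ m : ℕ, 0 < m →
      ∃ p ∈ S, (p : ℝ) ≤ D₁ * Real.log m + D₂ ∧ ¬ (p ∣ m) := by
  refine ⟨1 / C₁, M, by positivity, hM, fun m hm => ?_⟩
  by_contra! hdvd
  set x : ℝ := 1 / C₁ * Real.log m + M with hx
  have hlogm : 0 ≤ Real.log m := Real.log_natCast_nonneg m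
  have hMx : M ≤ x := le_add_of_nonneg_left (by positivity)
  have hprod : ∏ p ∈ (Finset.range (⌊x⌋₊ + 1)).filter (· ∈ S), p ∣ m := by
    refine Finset.prod_primes_dvd m (fun p hp => ?_) (fun p hp => ?_)
    · exact (hprime p (Finset.mem_filter.mp hp).2).prime
    · obtain ⟨hpx, hpS⟩ := Finset.mem_filter.mp hp
      refine hdvd p hpS ?_
      exact (Nat.le_floor_iff (hM.le.trans hMx)).mp (Nat.lt_succ_iff.mp (Finset.mem_range.mp hpx))
  have hlog : Real.log (∏ p ∈ (Finset.range (⌊x⌋₊ + 1)).filter (· ∈ S), (p : ℝ)) ≤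
      Real.log m := by
    rw [← Nat.cast_prod]
    exact Real.log_le_log (Nat.cast_pos.mpr (Nat.pos_of_dvd_of_pos hprod hm))
      (Nat.cast_le.mpr (Nat.le_of_dvd hm hprod))
  have hC₁x : C₁ * x = Real.log m + C₁ * M := by
    rw [hx]
    field_simp
  linarith [hlow x hMx, mul_pos hC₁ hM]
end
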